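/- Suppose d' = d and set q_0 = p^d, q_0* = (−1)^{(q_0−1)/2} q_0, and let √(q_0*) denote √(q_0) if q_0 ≡ 1 (mod 4) and i·√(q_0) if q_0 ≡ 3 (mod 4). Then, as (α,β) ranges over F_{p^m} × F_q, the value T(α,β) equals: p^m for exactly p^d(p^m−1)(p^m+1)^2/(2(p^d+1)) pairs; −p^m for exactly p^d(p^m−1)(p^n−2p^{n−d}+1)/(2(p^d−1)) pairs; √(q_0*)·p^m for exactly p^{m−d}(p^n−1)/2 pairs; −√(q_0*)·p^m for exactly p^{m−d}(p^n−1)/2 pairs; −p^{m+d} for exactly (p^{m−d}−1)(p^n−1)/(p^{2d}−1) pairs; and p^n for exactly 1 pair (namely (0,0)); T(α,β) takes no other values. -/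

import Mathlib

open scoped BigOperators Classical

noncomputable section

/-- The map `φ_{α,β}(x) = α x^{p^m} + β x^{p^k} + β^{p^{n-k}} x^{p^{n-k}}`. -/
def phiMap (p m n k : ℕ) {F : Type} [Field F] (α β x : F) : F :=
  α * x ^ p ^ m + β * x ^ p ^ k + β ^ p ^ (n - k) * x ^ p ^ (n - k)

/-- The trace-type sum `x ↦ ∑_{i<r} x^{p^{t i}}`; for `x` in the subfield of size
`p^{t·r}` this is the relative trace down to the subfield of size `p^t`. -/
def trSum (p t r : ℕ) {F : Type} [Field F] (x : F) : F :=
  ∑ i ∈ Finset.range r, x ^ p ^ (t * i)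

/-- `ζ_p^c = exp(2πi·c̃/p)` for a lift `c̃` of `c : F_p`. -/
noncomputable def expChar (p : ℕ) (c : ZMod p) : ℂ :=
  Complex.exp (2 * Real.pi * Complex.I * (c.val : ℂ) / (p : ℂ))

/-- Identify an element of the prime field of `F` with an element of `ZMod p`
(the partial inverse of the algebra map). -/
noncomputable def fToZMod (p : ℕ) {F : Type} [Field F] [Algebra (ZMod p) F] (x : F) : ZMod p :=
  letI : Nonempty (ZMod p) := ⟨0⟩
  Function.invFun (algebraMap (ZMod p) F) x

/-- `T(α,β) = ∑_{x ∈ F_q} ζ_p^{Tr^m_1(α x^{p^m+1}) + Tr^n_1(β x^{p^k+1})}`. -/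
noncomputable def Tsum (p m n k : ℕ) (F : Type) [Field F] [Fintype F] [Algebra (ZMod p) F]
    (α β : F) : ℂ :=
  ∑ x : F, expChar p (fToZMod p (trSum p 1 m (α * x ^ (p ^ m + 1))) +
      fToZMod p (trSum p 1 n (β * x ^ (p ^ k + 1))))

/-- `S(α,β,γ) = ∑_{x ∈ F_q} ζ_p^{Tr^m_1(α x^{p^m+1}) + Tr^n_1(β x^{p^k+1} + γ x)}`. -/
noncomputable def Ssum (p m n k : ℕ) (F : Type) [Field F] [Fintype F] [Algebra (ZMod p) F]
    (α β γ : F) : ℂ :=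
  ∑ x : F, expChar p (fToZMod p (trSum p 1 m (α * x ^ (p ^ m + 1))) +
      fToZMod p (trSum p 1 n (β * x ^ (p ^ k + 1) + γ * x)))

/-- `√(q₀*)` where `q₀* = (−1)^{(q₀−1)/2} q₀`. -/
noncomputable def sqrtStar (q0 : ℕ) : ℂ :=
  if q0 % 4 = 1 then (Real.sqrt q0 : ℂ) else Complex.I * (Real.sqrt q0 : ℂ)

/-- `ζ_p = exp(2πi/p)`. -/
noncomputable def zetaC (p : ℕ) : ℂ := Complex.exp (2 * Real.pi * Complex.I / (p : ℂ))

/-- Number of pairs `(α,β) ∈ F_{p^m} × F_q` with `T(α,β) = v`. -/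
noncomputable def Tcount (p m n k : ℕ) (F : Type) [Field F] [Fintype F] [Algebra (ZMod p) F]
    (v : ℂ) : ℕ :=
  Nat.card {ab : F × F // ab.1 ^ p ^ m = ab.1 ∧ Tsum p m n k F ab.1 ab.2 = v}

/-- Number of triples `(α,β,γ) ∈ F_{p^m} × F_q × F_q` with `S(α,β,γ) = v`. -/
noncomputable def Scount (p m n k : ℕ) (F : Type) [Field F] [Fintype F] [Algebra (ZMod p) F]
    (v : ℂ) : ℕ :=
  Nat.card {abc : F × F × F // abc.1 ^ p ^ m = abc.1 ∧ Ssum p m n k F abc.1 abc.2.1 abc.2.2 = v}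

/-- Hamming weight of the codeword of `C₁` attached to `(α,β)`:
the number of `0 ≤ i ≤ q-2` with `Tr^m_t(α π^{i(p^m+1)}) + Tr^n_t(β π^{i(p^k+1)}) ≠ 0`. -/
noncomputable def wt1 (p m n k t : ℕ) {F : Type} [Field F] (π α β : F) : ℕ :=
  Nat.card {i : ℕ // i ≤ p ^ n - 2 ∧
    trSum p t (m / t) (α * π ^ (i * (p ^ m + 1))) +
    trSum p t (n / t) (β * π ^ (i * (p ^ k + 1))) ≠ 0}

/-- Number of pairs `(α,β) ∈ F_{p^m} × F_q` whose `C₁`-codeword has weight `v`. -/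
noncomputable def wt1count (p m n k t : ℕ) (F : Type) [Field F] [Fintype F] (π : F) (v : ℕ) : ℕ :=
  Nat.card {ab : F × F // ab.1 ^ p ^ m = ab.1 ∧ wt1 p m n k t π ab.1 ab.2 = v}

/-- Hamming weight of the codeword of `C₂` attached to `(α,β,γ)`. -/
noncomputable def wt2 (p m n k t : ℕ) {F : Type} [Field F] (π α β γ : F) : ℕ :=
  Nat.card {i : ℕ // i ≤ p ^ n - 2 ∧
    trSum p t (m / t) (α * π ^ (i * (p ^ m + 1))) +
    trSum p t (n / t) (β * π ^ (i * (p ^ k + 1)) + γ * π ^ i) ≠ 0}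

/-- Number of triples `(α,β,γ)` whose `C₂`-codeword has weight `v`. -/
noncomputable def wt2count (p m n k t : ℕ) (F : Type) [Field F] [Fintype F] (π : F) (v : ℕ) : ℕ :=
  Nat.card {abc : F × F × F // abc.1 ^ p ^ m = abc.1 ∧ wt2 p m n k t π abc.1 abc.2.1 abc.2.2 = v}

open Finset in
/-- The square of the quadratic exponential sum of a nontrivial additive character. -/
lemma sq_sum_addChar_sq {E : Type*} [Field E] [Fintype E] (hE : ringChar E ≠ 2)
    {ψ : AddChar E ℂ} (hψ : ψ ≠ 1) :
    (∑ x, ψ (x ^ 2)) ^ 2 = (ZMod.χ₄ (Fintype.card E) : ℂ) * Fintype.card E := by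
  set χ : MulChar E ℂ := (quadraticChar E).ringHomComp (Int.castRingHom ℂ) with hχ
  have h1 : ∑ x, ψ (x ^ 2) = gaussSum χ ψ := by
    calc ∑ x, ψ (x ^ 2) = ∑ a, ((quadraticChar E a + 1 : ℤ) : ℂ) * ψ a := by
          rw [← sum_fiberwise_of_maps_to (g := fun x : E ↦ x ^ 2) (t := univ) fun _ _ ↦ mem_univ _]
          refine sum_congr rfl fun a _ ↦ ?_
          rw [← quadraticChar_card_sqrts hE a]
          rw [sum_congr rfl fun x hx ↦ by rw [(mem_filter.mp hx).2], sum_const, nsmul_eq_mul]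
          congr 2
          simp
      _ = ∑ a, χ a * ψ a + ∑ a, ψ a := by
          rw [← sum_add_distrib]
          refine sum_congr rfl fun a _ ↦ ?_
          simp [hχ, MulChar.ringHomComp_apply]; ring
      _ = gaussSum χ ψ := by
          rw [AddChar.sum_eq_zero_of_ne_one hψ, add_zero, gaussSum]
  have hχ1 : χ ≠ 1 := by
    intro h
    apply quadraticChar_ne_one hE
    ext a
    have := congrArg (fun f : MulChar E ℂ ↦ f a) h
    simp only [hχ, MulChar.ringHomComp_apply] at this
    simpa using this
  have hχ2 : χ.IsQuadratic := (quadraticChar_isQuadratic E).comp _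
  rw [h1, gaussSum_sq hχ1 hχ2 (AddChar.IsPrimitive.of_ne_one hψ), hχ, MulChar.ringHomComp_apply,
    quadraticChar_neg_one hE]
  rfl

open Finset in
/-- A finite field `F` of odd characteristic with an automorphism `σ`, a commuting involution `τ`
and a nontrivial additive character invariant under both; `σ` and `τ` have no common
nonzero anti-invariant. -/
structure TwistedField (F : Type) [Field F] [Fintype F] where
  σ : F ≃+* F
  τ : F ≃+* F
  e : AddChar F ℂ
  two_ne : (2 : F) ≠ 0
  comm : ∀ x, σ (τ x) = τ (σ x)
  invol : ∀ x, τ (τ x) = x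
  prim : e.IsPrimitive
  e_σ : ∀ x, e (σ x) = e x
  e_τ : ∀ x, e (τ x) = e x
  anti : ∀ v, τ v = -v → σ v = -v → v = 0
  card_eq : Fintype.card F = #{x : F | τ x = x} ^ 2

namespace TwistedField

open Finset ComplexConjugate

variable {F : Type} [Field F] [Fintype F] (D : TwistedField F)

/-- The fixed field of `τ`. -/
def K : Finset F := {x | D.τ x = x}

/-- The fixed field of `σ ∘ τ`. -/
def L : Finset F := {x | D.σ (D.τ x) = x}

/-- The quadratic form `x ↦ (α/2) x τ(x) + β x σ(x)`, only used under the character `e`. -/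
def form (α β x : F) : F := α / 2 * (x * D.τ x) + β * (x * D.σ x)

/-- The exponential sum attached to `form α β`. -/
def T (α β : F) : ℂ := ∑ x, D.e (D.form α β x)

/-- The linear map whose kernel is the radical of `form α β`. -/
def polar (α β x : F) : F := α * D.τ x + β * D.σ x + D.σ.symm (β * x)

/-- The radical of `form α β`. -/
def rad (α β : F) : Finset F := {x | D.polar α β x = 0}

@[simp] lemma mem_K {x : F} : x ∈ D.K ↔ D.τ x = x := by simp [K]

@[simp] lemma mem_L {x : F} : x ∈ D.L ↔ D.σ (D.τ x) = x := by simp [L]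

@[simp] lemma mem_rad {α β x : F} : x ∈ D.rad α β ↔ D.polar α β x = 0 := by simp [rad]

lemma card_eq' : Fintype.card F = #D.K ^ 2 := D.card_eq

lemma e_symm (x : F) : D.e (D.σ.symm x) = D.e x := by
  rw [← D.e_σ (D.σ.symm x), RingEquiv.apply_symm_apply]

lemma e_sum (b : F) : ∑ x, D.e (x * b) = if b = 0 then (Fintype.card F : ℂ) else 0 := by
  classical
  have := AddChar.sum_mulShift b D.prim
  rw [this]; split_ifs <;> simp

lemma τ_two : D.τ 2 = 2 := map_ofNat _ _

lemma σ_two : D.σ 2 = 2 := map_ofNat _ _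

lemma zero_mem_K : (0 : F) ∈ D.K := by simp

lemma mem_L_iff {x : F} : x ∈ D.L ↔ D.τ x = x ∧ D.σ x = x := by
  rw [mem_L]
  constructor
  · intro h
    have h1 : D.σ x = D.τ x := by
      have := congrArg D.τ h
      rwa [← D.comm, D.invol] at this
    have h2 : x - D.τ x = 0 := by
      apply D.anti
      · rw [map_sub, D.invol]; ring
      · rw [map_sub, h, h1]; ring
    have h3 : D.τ x = x := (sub_eq_zero.mp h2).symm
    exact ⟨h3, h1.trans h3⟩
  · rintro ⟨h1, h2⟩
    rw [h1, h2]

/-- Summing the character over the fixed points of an automorphism `ρ` counts preimages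
under `1 - ρ`. -/
lemma sum_fixed (ρ : F ≃+* F) (hρ : ∀ x, D.e (ρ x) = D.e x) (y : F) :
    ∑ μ with ρ μ = μ, D.e (μ * y) = #{z : F | z - ρ z = y} := by
  have hs : ∀ x, D.e (ρ.symm x) = D.e x := fun x ↦ by
    rw [← hρ (ρ.symm x), RingEquiv.apply_symm_apply]
  have hq : (Fintype.card F : ℂ) ≠ 0 := by simp [Fintype.card_ne_zero]
  have key : ∑ z : F, ∑ μ : F, D.e (μ * (y - (z - ρ z)))
      = Fintype.card F * ∑ μ with ρ μ = μ, D.e (μ * y) := by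
    rw [sum_comm, mul_sum, sum_filter]
    refine sum_congr rfl fun μ _ ↦ ?_
    have : ∀ z, D.e (μ * (y - (z - ρ z))) = D.e (μ * y) * D.e (z * (ρ.symm μ - μ)) := by
      intro z
      have h1 : μ * (y - (z - ρ z)) = μ * y + (μ * ρ z + (-(z * μ))) := by ring
      have h2 : D.e (μ * ρ z) = D.e (ρ.symm μ * z) := by
        rw [← hs (μ * ρ z), map_mul, RingEquiv.symm_apply_apply]
      rw [h1, AddChar.map_add_eq_mul, AddChar.map_add_eq_mul, h2, ← AddChar.map_add_eq_mul]
      congr 2; ring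
    simp_rw [this, ← mul_sum, D.e_sum]
    have hiff : ρ.symm μ - μ = 0 ↔ ρ μ = μ := by
      rw [sub_eq_zero, RingEquiv.symm_apply_eq, eq_comm]
    by_cases h : ρ μ = μ
    · rw [if_pos (hiff.mpr h), if_pos h, mul_comm]
    · rw [if_neg (mt hiff.mp h), if_neg h]; ring
  simp_rw [D.e_sum] at key
  have : ∀ z : F, (y - (z - ρ z) = 0) ↔ z - ρ z = y := fun z ↦ by rw [sub_eq_zero, eq_comm]
  simp_rw [this] at key
  rw [← sum_filter, sum_const, nsmul_eq_mul, mul_comm] at key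
  exact (mul_left_cancel₀ hq key).symm

lemma sum_K {y : F} (hy : y ∈ D.K) :
    ∑ μ ∈ D.K, D.e (μ * y) = if y = 0 then (#D.K : ℂ) else 0 := by
  split_ifs with h
  · simp [h]
  · rw [K, D.sum_fixed D.τ D.e_τ, Nat.cast_eq_zero, card_eq_zero, filter_eq_empty_iff]
    intro z _ hz
    have h1 : D.τ y = -y := by rw [← hz, map_sub, D.invol]; ring
    rw [D.mem_K.mp hy] at h1
    apply h
    have : (2 : F) * y = 0 := by linear_combination h1
    exact (mul_eq_zero.mp this).resolve_left D.two_ne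

lemma sum_L (y : F) :
    ∑ μ ∈ D.L, D.e (μ * y) = #{z : F | z - D.σ (D.τ z) = y} :=
  D.sum_fixed (D.τ.trans D.σ) (fun x ↦ by simp [D.e_σ, D.e_τ]) y

/-- Second moment over the variable: `|T|² = q |rad|`. -/
lemma T_mul_conj {α : F} (hα : α ∈ D.K) (β : F) :
    D.T α β * conj (D.T α β) = Fintype.card F * #(D.rad α β) := by
  have h2 := D.two_ne
  have hαK : D.τ α = α := D.mem_K.mp hα
  have hpol : ∀ y z, D.e (D.form α β (y + z) - D.form α β y)
      = D.e (D.form α β z) * D.e (y * D.polar α β z) := by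
    intro y z
    have e1 : D.form α β (y + z) - D.form α β y = D.form α β z
        + (α / 2 * (y * D.τ z) + α / 2 * (z * D.τ y) + β * y * D.σ z + β * z * D.σ y) := by
      simp only [form, map_add]; ring
    have e2 : D.e (α / 2 * (z * D.τ y)) = D.e (α / 2 * (y * D.τ z)) := by
      rw [← D.e_τ (α / 2 * (z * D.τ y))]
      simp only [map_mul, map_div₀, D.τ_two, D.invol, hαK]
      congr 1; ring
    have e3 : D.e (β * z * D.σ y) = D.e (y * D.σ.symm (β * z)) := by
      rw [← D.e_symm, map_mul, RingEquiv.symm_apply_apply, mul_comm]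
    have e4 : y * D.polar α β z = α / 2 * (y * D.τ z) + α / 2 * (y * D.τ z) + β * y * D.σ z
        + y * D.σ.symm (β * z) := by
      simp only [polar]; field_simp; ring
    rw [e1, AddChar.map_add_eq_mul, e4]
    congr 1
    simp only [AddChar.map_add_eq_mul]
    rw [e2, e3]
  have hrad : ∀ z ∈ D.rad α β, D.e (D.form α β z) = 1 := by
    intro z hz
    have hz' : D.polar α β z = 0 := D.mem_rad.mp hz
    have e1 : α / 2 * (z * D.τ z) + β * (z * D.σ z) / 2 + D.σ.symm (β * (z * D.σ z) / 2) = 0 := by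
      have : D.σ.symm (β * (z * D.σ z) / 2) = D.σ.symm (β * z) * z / 2 := by
        rw [map_div₀, map_ofNat, ← mul_assoc, map_mul, RingEquiv.symm_apply_apply]
      rw [this]
      simp only [polar] at hz'
      generalize D.σ.symm (β * z) = u at hz' ⊢
      field_simp
      linear_combination z * hz'
    have e2 := congrArg D.e e1
    rw [AddChar.map_add_eq_mul, D.e_symm, ← AddChar.map_add_eq_mul, AddChar.map_zero_eq_one] at e2
    rw [← e2, form]
    congr 1
    field_simp; ring
  calc D.T α β * conj (D.T α β)
      = ∑ y, ∑ x, D.e (D.form α β x - D.form α β y) := by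
        rw [T, map_sum, sum_mul_sum, sum_comm]
        refine sum_congr rfl fun y _ ↦ sum_congr rfl fun x _ ↦ ?_
        rw [sub_eq_add_neg, AddChar.map_add_eq_mul, AddChar.map_neg_eq_conj]
    _ = ∑ y, ∑ z, D.e (D.form α β z) * D.e (y * D.polar α β z) := by
        refine sum_congr rfl fun y _ ↦ ?_
        rw [← Equiv.sum_comp (Equiv.addLeft y)]
        exact sum_congr rfl fun z _ ↦ hpol y z
    _ = ∑ z, if D.polar α β z = 0 then (Fintype.card F : ℂ) else 0 := by
        rw [sum_comm]
        refine sum_congr rfl fun z _ ↦ ?_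
        rw [← mul_sum, D.e_sum]
        split_ifs with h
        · rw [hrad z (D.mem_rad.mpr h), one_mul]
        · rw [mul_zero]
    _ = _ := by
        rw [← sum_filter, sum_const, nsmul_eq_mul, mul_comm, rad]

lemma T_zero_zero : D.T 0 0 = Fintype.card F := by
  simp [T, form]

lemma form_scale (α β x z : F) :
    D.form α β (x * z) = D.form (α * (x * D.τ x)) (β * (x * D.σ x)) z := by
  simp only [form, map_mul]; ring

lemma T_scale (α β : F) {x : F} (hx : x ≠ 0) :
    D.T α β = D.T (α * (x * D.τ x)) (β * (x * D.σ x)) := by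
  rw [T, ← Equiv.sum_comp (Equiv.mulLeft₀ x hx)]
  exact sum_congr rfl fun z _ ↦ by rw [← form_scale]; rfl

lemma mem_rad_iff {α β x : F} (hα : α ∈ D.K) (hx : x ≠ 0) : x ∈ D.rad α β ↔
    β * (x * D.σ x) ∈ D.K ∧
      α * (x * D.τ x) = -(β * (x * D.σ x) + D.σ.symm (β * (x * D.σ x))) := by
  set w := β * (x * D.σ x) with hw
  have h0 : x * D.polar α β x = α * (x * D.τ x) + (w + D.σ.symm w) := by
    rw [polar, hw, map_mul, map_mul, map_mul, RingEquiv.symm_apply_apply]; ring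
  have h1 : x ∈ D.rad α β ↔ α * (x * D.τ x) = -(w + D.σ.symm w) := by
    rw [mem_rad, ← mul_right_inj' hx, h0, mul_zero, add_eq_zero_iff_eq_neg]
  rw [h1]
  refine ⟨fun h ↦ ⟨?_, h⟩, fun h ↦ h.2⟩
  have hcs : ∀ v, D.τ (D.σ.symm v) = D.σ.symm (D.τ v) := fun v ↦ by
    rw [RingEquiv.eq_symm_apply, D.comm, RingEquiv.apply_symm_apply]
  have h2 : D.τ (w + D.σ.symm w) = w + D.σ.symm w := by
    have h3 : w + D.σ.symm w = -(α * (x * D.τ x)) := by rw [h, neg_neg]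
    rw [h3]
    simp only [map_neg, map_mul, D.invol, D.mem_K.mp hα]
    ring
  rw [map_add, hcs] at h2
  have h4 : w - D.τ w = 0 := by
    apply D.anti
    · rw [map_sub, D.invol]; ring
    · have h5 := congrArg D.σ h2
      simp only [map_add, RingEquiv.apply_symm_apply] at h5
      rw [map_sub]
      linear_combination -h5
  exact D.mem_K.mpr (sub_eq_zero.mp h4).symm

/-- The values of `T` at the pairs with `1` in the radical. -/
def t (w : F) : ℂ := D.T (-(w + D.σ.symm w)) w

lemma t_zero : D.t 0 = Fintype.card F := by
  simp [t, T_zero_zero]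

lemma neg_add_symm_mem {w : F} (hw : w ∈ D.K) : -(w + D.σ.symm w) ∈ D.K := by
  have : D.τ (D.σ.symm w) = D.σ.symm w := by
    rw [RingEquiv.eq_symm_apply, D.comm, RingEquiv.apply_symm_apply, D.mem_K.mp hw]
  rw [mem_K, map_neg, map_add, this, D.mem_K.mp hw]

lemma sum_nonzero_rad {x : F} (hx : x ≠ 0) (φ : ℂ → ℂ) :
    ∑ α ∈ D.K, ∑ β, (if x ∈ D.rad α β then φ (D.T α β) else 0) = ∑ w ∈ D.K, φ (D.t w) := by
  have hτx : D.τ x ≠ 0 := by simpa using hx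
  have hσx : D.σ x ≠ 0 := by simpa using hx
  have hN : x * D.τ x ≠ 0 := mul_ne_zero hx hτx
  have hS : x * D.σ x ≠ 0 := mul_ne_zero hx hσx
  have hNK : D.τ (x * D.τ x) = x * D.τ x := by rw [map_mul, D.invol, mul_comm]
  calc ∑ α ∈ D.K, ∑ β, (if x ∈ D.rad α β then φ (D.T α β) else 0)
      = ∑ α ∈ D.K, ∑ w, (if w ∈ D.K ∧ α * (x * D.τ x) = -(w + D.σ.symm w)
          then φ (D.T (α * (x * D.τ x)) w) else 0) := by
        refine sum_congr rfl fun α hα ↦ ?_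
        rw [← Equiv.sum_comp (Equiv.mulRight₀ _ hS) fun w ↦ if w ∈ D.K ∧
          α * (x * D.τ x) = -(w + D.σ.symm w) then φ (D.T (α * (x * D.τ x)) w) else 0]
        refine sum_congr rfl fun β _ ↦ ?_
        change _ = if β * (x * D.σ x) ∈ D.K ∧ _ then φ (D.T _ (β * (x * D.σ x))) else 0
        rw [← D.T_scale α β hx]
        simp only [D.mem_rad_iff hα hx]
        rfl
    _ = ∑ a ∈ D.K, ∑ w, (if w ∈ D.K ∧ a = -(w + D.σ.symm w) then φ (D.T a w) else 0) := by
        refine sum_bij' (fun α _ ↦ α * (x * D.τ x)) (fun a _ ↦ a / (x * D.τ x)) ?_ ?_ ?_ ?_ ?_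
        · intro a ha
          rw [mem_K, map_mul, hNK, D.mem_K.mp ha]
        · intro a ha
          rw [mem_K, map_div₀, hNK, D.mem_K.mp ha]
        · intro a _
          exact mul_div_cancel_right₀ a hN
        · intro a _
          exact div_mul_cancel₀ a hN
        · intro a _; rfl
    _ = ∑ w ∈ D.K, φ (D.t w) := by
        rw [sum_comm, ← sum_filter_add_sum_filter_not univ (· ∈ D.K), filter_mem_eq_inter,
          univ_inter]
        have hz : ∑ w with w ∉ D.K, ∑ a ∈ D.K,
            (if w ∈ D.K ∧ a = -(w + D.σ.symm w) then φ (D.T a w) else 0) = 0 := by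
          refine sum_eq_zero fun w hw ↦ sum_eq_zero fun a _ ↦ ?_
          rw [if_neg fun h ↦ (mem_filter.mp hw).2 h.1]
        rw [hz, add_zero]
        refine sum_congr rfl fun w hw ↦ ?_
        simp only [hw, true_and]
        rw [sum_ite_eq', if_pos (D.neg_add_symm_mem hw), t]

lemma zero_mem_rad (α β : F) : (0 : F) ∈ D.rad α β := by simp [polar]

lemma sum_card_rad (φ : ℂ → ℂ) :
    ∑ α ∈ D.K, ∑ β, ((#(D.rad α β) : ℂ) - 1) * φ (D.T α β)
      = (Fintype.card F - 1) * ∑ w ∈ D.K, φ (D.t w) := by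
  have h1 : ∀ α β, ((#(D.rad α β) : ℂ) - 1) * φ (D.T α β)
      = ∑ x ∈ univ.erase 0, if x ∈ D.rad α β then φ (D.T α β) else 0 := by
    intro α β
    rw [sum_erase_eq_sub (mem_univ 0), if_pos (D.zero_mem_rad α β), ← sum_filter,
      filter_mem_eq_inter, univ_inter, sum_const, nsmul_eq_mul]
    ring
  simp_rw [h1]
  have h2 : ∑ α ∈ D.K, ∑ β, ∑ x ∈ univ.erase 0, (if x ∈ D.rad α β then φ (D.T α β) else 0)
      = ∑ x ∈ univ.erase (0 : F), ∑ w ∈ D.K, φ (D.t w) := by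
    rw [← sum_congr rfl fun x hx ↦ D.sum_nonzero_rad (ne_of_mem_erase hx) φ, sum_comm]
    rw [← sum_comm]
    conv_rhs => rw [sum_comm]
    exact sum_congr rfl fun α _ ↦ sum_comm
  rw [h2, sum_const, nsmul_eq_mul, card_erase_of_mem (mem_univ _), card_univ,
    Nat.cast_sub Fintype.card_pos, Nat.cast_one]

lemma T_zero_right {α : F} (hα : α ∈ D.K) (h0 : α ≠ 0) : D.T α 0 = -(#D.K : ℂ) := by
  have hn : ∀ a ∈ D.K.erase 0, D.T a 0 * conj (D.T a 0) = (#D.K : ℂ) ^ 2 := by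
    intro a ha
    obtain ⟨ha0, haK⟩ := mem_erase.mp ha
    have hr : D.rad a 0 = {0} := by
      ext x; simp [polar, ha0]
    rw [D.T_mul_conj haK, hr, D.card_eq']; simp
  have hn' : ∀ a ∈ D.K.erase 0, (D.T a 0).re ^ 2 + (D.T a 0).im ^ 2 = (#D.K : ℝ) ^ 2 := by
    intro a ha
    have h1 := hn a ha
    rw [Complex.mul_conj, Complex.normSq_apply] at h1
    have h2 : (D.T a 0).re * (D.T a 0).re + (D.T a 0).im * (D.T a 0).im = (#D.K : ℝ) ^ 2 := by
      exact_mod_cast h1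
    linarith
  have hsum : ∑ a ∈ D.K, D.T a 0 = #D.K := by
    have h1 : ∀ x, ∑ a ∈ D.K, D.e (D.form a 0 x) = if x = 0 then (#D.K : ℂ) else 0 := by
      intro x
      have hx : x * D.τ x / 2 ∈ D.K := by
        rw [mem_K, map_div₀, map_mul, D.invol, D.τ_two, mul_comm]
      have h2 := D.sum_K hx
      have h3 : x * D.τ x / 2 = 0 ↔ x = 0 := by simp [D.two_ne]
      simp only [h3] at h2
      rw [← h2]
      refine sum_congr rfl fun a _ ↦ ?_
      rw [form]; congr 1; ring
    simp only [T]
    rw [sum_comm, sum_congr rfl fun x _ ↦ h1 x, sum_ite_eq', if_pos (mem_univ _)]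
  have hre : ∀ a ∈ D.K.erase 0, 0 ≤ (D.T a 0).re + #D.K := by
    intro a ha
    have h1 : (D.T a 0).re ^ 2 ≤ (#D.K : ℝ) ^ 2 := by nlinarith [hn' a ha, sq_nonneg (D.T a 0).im]
    have := abs_le_of_sq_le_sq' h1 (Nat.cast_nonneg _)
    linarith [this.1]
  have hs0 : ∑ a ∈ D.K.erase 0, ((D.T a 0).re + #D.K) = 0 := by
    rw [sum_erase_eq_sub D.zero_mem_K, sum_add_distrib, sum_const, nsmul_eq_mul, ← Complex.re_sum,
      hsum, D.T_zero_zero, D.card_eq']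
    push_cast
    rw [← Nat.cast_pow, Complex.natCast_re, Complex.natCast_re]
    push_cast; ring
  have hz := (sum_eq_zero_iff_of_nonneg hre).mp hs0 α (mem_erase.mpr ⟨h0, hα⟩)
  have hre' : (D.T α 0).re = -#D.K := by linarith
  have him : (D.T α 0).im = 0 := by
    have := hn' α (mem_erase.mpr ⟨h0, hα⟩)
    rw [hre'] at this
    have h2 : (D.T α 0).im ^ 2 = 0 := by linarith
    simpa using h2
  apply Complex.ext <;> simp [hre', him]

/-- The quadratic Gauss sum over `L` attached to `s`. -/
def gauss (s : F) : ℂ := ∑ l ∈ D.L, D.e (l ^ 2 * s / 2)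

lemma gauss_zero : D.gauss 0 = #D.L := by simp [gauss]

lemma e_half_trace (y : F) : D.e ((y + D.τ y) / 2) = D.e y := by
  have h2 := D.two_ne
  have h3 : y / 2 + y / 2 = y := by field_simp; ring
  have h1 : (y + D.τ y) / 2 = y / 2 + D.τ (y / 2) := by
    rw [map_div₀, D.τ_two]; ring
  rw [h1, AddChar.map_add_eq_mul, D.e_τ, ← AddChar.map_add_eq_mul, h3]

lemma t_eq {w : F} (hw : w ∈ D.K) (h0 : w ≠ 0) : D.t w = -(#D.K : ℂ) * D.gauss w⁻¹ := by
  have h2 := D.two_ne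
  have hwK : D.τ w = w := D.mem_K.mp hw
  set G : F → F := fun z ↦ z - D.σ (D.τ z) with hG
  have hform : ∀ z, D.e (D.form (-(w + D.σ.symm w)) w z)
      = D.e (-w / 2 * (G z * D.τ (G z))) := by
    intro z
    have e1 : D.e (D.σ.symm w / 2 * (z * D.τ z)) = D.e (w / 2 * (D.σ z * D.σ (D.τ z))) := by
      rw [← D.e_σ (D.σ.symm w / 2 * (z * D.τ z))]
      simp only [map_mul, map_div₀, D.σ_two, RingEquiv.apply_symm_apply]
    have e2 : D.e (w * (z * D.σ z)) = D.e (w / 2 * (z * D.σ z + D.τ z * D.τ (D.σ z))) := by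
      rw [← D.e_half_trace]
      simp only [map_mul, hwK]
      congr 1; ring
    have e3 : D.form (-(w + D.σ.symm w)) w z = -w / 2 * (z * D.τ z)
        + -(D.σ.symm w / 2 * (z * D.τ z)) + w * (z * D.σ z) := by
      rw [form]; ring
    rw [e3, AddChar.map_add_eq_mul, AddChar.map_add_eq_mul, AddChar.map_neg_eq_conj, e1, e2,
      ← AddChar.map_neg_eq_conj, ← AddChar.map_add_eq_mul, ← AddChar.map_add_eq_mul]
    congr 1
    simp only [hG, map_sub, ← D.comm, D.invol]
    ring
  have hshift : ∀ l ∈ D.L, ∑ y, D.e (l * y) * D.e (-w / 2 * (y * D.τ y))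
      = D.e (l ^ 2 * w⁻¹ / 2) * D.T (-w) 0 := by
    intro l hl
    have hlK : D.τ l = l := (D.mem_L_iff.mp hl).1
    rw [T, mul_sum, ← Equiv.sum_comp (Equiv.addRight (l / w))]
    refine sum_congr rfl fun y _ ↦ ?_
    change D.e (l * (y + l / w)) * D.e (-w / 2 * ((y + l / w) * D.τ (y + l / w))) = _
    rw [← D.e_half_trace (l * (y + l / w)), ← AddChar.map_add_eq_mul, ← AddChar.map_add_eq_mul]
    congr 1
    simp only [form, map_add, map_mul, map_div₀, hlK, hwK]
    field_simp
    ring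
  calc D.t w = ∑ z, D.e (-w / 2 * (G z * D.τ (G z))) := by
        rw [t, T]; exact sum_congr rfl fun z _ ↦ hform z
    _ = ∑ y, (#{z | G z = y} : ℂ) * D.e (-w / 2 * (y * D.τ y)) := by
        rw [← sum_fiberwise_of_maps_to (g := G) (t := univ) fun _ _ ↦ mem_univ _]
        refine sum_congr rfl fun y _ ↦ ?_
        rw [← nsmul_eq_mul, ← sum_const]
        exact sum_congr rfl fun z hz ↦ by rw [(mem_filter.mp hz).2]
    _ = ∑ y, ∑ l ∈ D.L, D.e (l * y) * D.e (-w / 2 * (y * D.τ y)) := by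
        refine sum_congr rfl fun y _ ↦ ?_
        rw [← sum_mul, D.sum_L]
    _ = ∑ l ∈ D.L, D.e (l ^ 2 * w⁻¹ / 2) * D.T (-w) 0 := by
        rw [sum_comm]; exact sum_congr rfl hshift
    _ = _ := by
        rw [← sum_mul, D.T_zero_right (by simp [hwK]) (neg_ne_zero.mpr h0), mul_comm]
        rfl

/-- `L` as a subfield. -/
def Lfield : Subfield F :=
  ((D.τ.trans D.σ : F ≃+* F) : F →+* F).eqLocusField (RingHom.id F)

lemma mem_Lfield {x : F} : x ∈ D.Lfield ↔ x ∈ D.L := by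
  rw [mem_L]; exact Iff.rfl

lemma sum_Lfield {A : Type*} [AddCommMonoid A] (f : F → A) :
    ∑ l : D.Lfield, f l = ∑ l ∈ D.L, f l :=
  (sum_subtype D.L (fun _ ↦ D.mem_Lfield.symm) f).symm

lemma card_Lfield : Fintype.card D.Lfield = #D.L := by
  rw [Fintype.card_eq_sum_ones, card_eq_sum_ones]
  exact D.sum_Lfield fun _ ↦ 1

lemma ringChar_Lfield : ringChar D.Lfield ≠ 2 := by
  intro h
  have h1 : ((2 : ℕ) : D.Lfield) = 0 := by rw [← h]; exact ringChar.Nat.cast_ringChar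
  apply D.two_ne
  have h2 := congrArg D.Lfield.subtype h1
  rwa [map_natCast, map_zero, Nat.cast_ofNat] at h2

/-- The linear character sum over `L` attached to `s`. -/
def lin (s : F) : ℂ := ∑ l ∈ D.L, D.e (l * (s / 2))

lemma gauss_lin (s : F) : (D.lin s = #D.L ∧ D.gauss s = #D.L) ∨
    (D.lin s = 0 ∧ D.gauss s ^ 2 = (ZMod.χ₄ (#D.L) : ℂ) * #D.L) := by
  let ψ : AddChar D.Lfield ℂ :=
    (D.e.mulShift (s / 2)).compAddMonoidHom D.Lfield.subtype.toAddMonoidHom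
  have hψ : ∀ l : D.Lfield, ψ l = D.e (l * (s / 2)) := fun l ↦ by
    simp only [ψ, AddChar.compAddMonoidHom_apply, AddChar.mulShift_apply]
    rw [mul_comm]; rfl
  have hlin : D.lin s = ∑ l, ψ l := by
    rw [lin, ← D.sum_Lfield]; exact sum_congr rfl fun l _ ↦ (hψ l).symm
  have hgauss : D.gauss s = ∑ l, ψ (l ^ 2) := by
    rw [gauss, ← D.sum_Lfield fun l ↦ D.e (l ^ 2 * s / 2)]
    refine sum_congr rfl fun l _ ↦ ?_
    rw [hψ]; congr 1; push_cast; ring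
  by_cases h : ψ = 1
  · left
    rw [hlin, hgauss, h, ← D.card_Lfield]
    simp
  · right
    rw [hlin, hgauss, AddChar.sum_eq_zero_of_ne_one h, sq_sum_addChar_sq D.ringChar_Lfield h,
      D.card_Lfield]
    exact ⟨rfl, rfl⟩

lemma sum_lin : ∑ s ∈ D.K, D.lin s = #D.K := by
  simp only [lin]
  rw [sum_comm]
  have : ∀ l ∈ D.L, ∑ s ∈ D.K, D.e (l * (s / 2)) = if l = 0 then (#D.K : ℂ) else 0 := by
    intro l hl
    have hK : l / 2 ∈ D.K := by rw [mem_K, map_div₀, (D.mem_L_iff.mp hl).1, D.τ_two]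
    have h0 : l / 2 = 0 ↔ l = 0 := by simp [D.two_ne]
    have := D.sum_K hK
    simp only [h0] at this
    rw [← this]
    exact sum_congr rfl fun s _ ↦ by congr 1; ring
  rw [sum_congr rfl this, sum_ite_eq', if_pos (by simp)]

lemma sum_gauss : ∑ s ∈ D.K, D.gauss s = #D.K := by
  simp only [gauss]
  rw [sum_comm]
  have : ∀ l ∈ D.L, ∑ s ∈ D.K, D.e (l ^ 2 * s / 2) = if l = 0 then (#D.K : ℂ) else 0 := by
    intro l hl
    have hK : l ^ 2 / 2 ∈ D.K := by rw [mem_K, map_div₀, map_pow, (D.mem_L_iff.mp hl).1, D.τ_two]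
    have h0 : l ^ 2 / 2 = 0 ↔ l = 0 := by simp [D.two_ne]
    have := D.sum_K hK
    simp only [h0] at this
    rw [← this]
    exact sum_congr rfl fun s _ ↦ by congr 1; ring
  rw [sum_congr rfl this, sum_ite_eq', if_pos (by simp)]

lemma card_sqrt_neg_one : (#{u ∈ D.L | u ^ 2 = -1} : ℤ) = ZMod.χ₄ (#D.L) + 1 := by
  have h := quadraticChar_card_sqrts D.ringChar_Lfield (-1)
  rw [quadraticChar_neg_one D.ringChar_Lfield, D.card_Lfield] at h
  rw [← h, card_filter, ← D.sum_Lfield fun u ↦ if u ^ 2 = -1 then 1 else 0, ← card_filter]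
  congr 2
  ext u
  simp [Subtype.ext_iff]

/-- A chosen square root of `χ₄(#L) #L`; the values of `gauss` are `#L`, `r` and `-r`. -/
lemma gauss_values {r : ℂ} (hr : r ^ 2 = (ZMod.χ₄ (#D.L) : ℂ) * #D.L) (s : F) :
    D.gauss s = #D.L ∨ D.gauss s = r ∨ D.gauss s = -r := by
  rcases D.gauss_lin s with ⟨_, h⟩ | ⟨_, h⟩
  · exact Or.inl h
  · exact Or.inr (sq_eq_sq_iff_eq_or_eq_neg.mp (h.trans hr.symm))

lemma card_pos_K : 0 < #D.K := card_pos.mpr ⟨0, D.zero_mem_K⟩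

lemma χ₄_card_L : ZMod.χ₄ (#D.L) = 1 ∨ ZMod.χ₄ (#D.L) = -1 := by
  have h := FiniteField.odd_card_of_char_ne_two D.ringChar_Lfield
  rw [D.card_Lfield] at h
  rw [ZMod.χ₄_eq_neg_one_pow h]
  exact neg_one_pow_eq_or ℤ _

lemma one_lt_card_L : 1 < #D.L := by
  rw [← D.card_Lfield]; exact Fintype.one_lt_card

/-- Distribution of the values of `gauss` on `K`. -/
lemma sum_comp_gauss {r : ℂ} (hr : r ^ 2 = (ZMod.χ₄ (#D.L) : ℂ) * #D.L) {R : ℕ}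
    (hR : #D.K = #D.L * R) (φ : ℂ → ℂ) :
    ∑ s ∈ D.K, φ (D.gauss s)
      = R * φ (#D.L) + ((#D.K : ℂ) - R) / 2 * (φ r + φ (-r)) := by
  have hQ : (1 : ℝ) < #D.L := by exact_mod_cast D.one_lt_card_L
  have hQ0 : (#D.L : ℂ) ≠ 0 := by
    have := D.one_lt_card_L
    exact_mod_cast (by omega : #D.L ≠ 0)
  have hQ1 : (#D.L : ℂ) ≠ 1 := by exact_mod_cast D.one_lt_card_L.ne'
  have hθ : (ZMod.χ₄ (#D.L) : ℂ) = 1 ∨ (ZMod.χ₄ (#D.L) : ℂ) = -1 := by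
    rcases D.χ₄_card_L with h | h <;> simp [h]
  have hr0 : r ≠ 0 := by
    rintro rfl
    rcases hθ with h | h <;> rw [h] at hr <;> exact hQ0 (by simpa using hr.symm)
  have hrQ : r ^ 2 ≠ (#D.L : ℂ) ^ 2 := by
    intro h
    rw [hr] at h
    have hsq : (ZMod.χ₄ (#D.L) : ℂ) = #D.L := by
      apply mul_right_cancel₀ hQ0; rw [h, sq]
    rcases hθ with h' | h' <;> rw [h'] at hsq
    · exact hQ1 hsq.symm
    · have h3 : ((-1 : ℤ) : ℂ) = ((#D.L : ℤ) : ℂ) := by push_cast; exact hsq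
      have h4 : (-1 : ℤ) = (#D.L : ℤ) := by exact_mod_cast h3
      omega
  have hrne : r ≠ -r := by
    intro h
    apply hr0
    linear_combination h / 2
  have h1 : r ≠ #D.L := fun h ↦ hrQ (by rw [h])
  have h2 : -r ≠ #D.L := fun h ↦ hrQ (by rw [← h, neg_sq])
  have hlinval : ∀ s, D.lin s = if D.gauss s = #D.L then (#D.L : ℂ) else 0 := by
    intro s
    rcases D.gauss_lin s with ⟨h, h'⟩ | ⟨h, h'⟩
    · rw [h, if_pos h']
    · rw [h, if_neg]
      intro h''
      apply hrQ
      rw [hr, ← h', h'']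
  set n0 : ℂ := ((#{s ∈ D.K | D.gauss s = #D.L} : ℕ) : ℂ) with hn0
  set n1 : ℂ := ((#{s ∈ D.K | D.gauss s = r} : ℕ) : ℂ) with hn1
  set n2 : ℂ := ((#{s ∈ D.K | D.gauss s = -r} : ℕ) : ℂ) with hn2
  have hgen : ∀ f : ℂ → ℂ, ∑ s ∈ D.K, f (D.gauss s) = n0 * f (#D.L) + n1 * f r + n2 * f (-r) := by
    intro f
    have hpt : ∀ s, f (D.gauss s) = (if D.gauss s = #D.L then f (#D.L) else 0)
        + (if D.gauss s = r then f r else 0) + (if D.gauss s = -r then f (-r) else 0) := by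
      intro s
      rcases D.gauss_values hr s with h | h | h
      · rw [h, if_pos rfl, if_neg h1.symm, if_neg h2.symm]; ring
      · rw [h, if_neg h1, if_pos rfl, if_neg hrne]; ring
      · rw [h, if_neg h2, if_neg hrne.symm, if_pos rfl]; ring
    rw [sum_congr rfl fun s _ ↦ hpt s, sum_add_distrib, sum_add_distrib, ← sum_filter,
      ← sum_filter, ← sum_filter]
    simp only [sum_const, nsmul_eq_mul, hn0, hn1, hn2]
  have e0 : n0 = R := by
    have h := D.sum_lin
    rw [sum_congr rfl fun s _ ↦ hlinval s, ← sum_filter, sum_const, nsmul_eq_mul, hR] at h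
    push_cast at h
    apply mul_right_cancel₀ hQ0
    rw [hn0, h]; ring
  have e1 := hgen fun _ ↦ 1
  have e2 := hgen fun z ↦ z
  rw [D.sum_gauss] at e2
  simp only [sum_const, nsmul_eq_mul, mul_one] at e1
  have hK : (#D.K : ℂ) = #D.L * R := by exact_mod_cast hR
  have e3 : n1 = n2 := by
    apply mul_right_cancel₀ hr0
    rw [e0] at e2
    linear_combination hK - e2
  rw [hgen φ, e0]
  rw [e0, ← e3] at e1
  have e4 : n1 = ((#D.K : ℂ) - R) / 2 := by rw [e1]; ring
  rw [← e3, e4]; ring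

/-- The weighted distribution of the values of `T` on the degenerate pairs. -/
lemma sum_card_rad_eq {r : ℂ} (hr : r ^ 2 = (ZMod.χ₄ (#D.L) : ℂ) * #D.L) {R : ℕ}
    (hR : #D.K = #D.L * R) (φ : ℂ → ℂ) :
    ∑ α ∈ D.K, ∑ β, ((#(D.rad α β) : ℂ) - 1) * φ (D.T α β)
      = ((#D.K : ℂ) ^ 2 - 1) * (φ ((#D.K : ℂ) ^ 2) + (R - 1) * φ (-(#D.K * #D.L))
        + ((#D.K : ℂ) - R) / 2 * (φ (#D.K * r) + φ (-(#D.K * r)))) := by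
  rw [D.sum_card_rad, D.card_eq']
  push_cast
  congr 1
  have h1 : ∑ w ∈ D.K.erase 0, φ (D.t w) = ∑ s ∈ D.K.erase 0, φ (-(#D.K : ℂ) * D.gauss s) := by
    refine sum_bij' (fun w _ ↦ w⁻¹) (fun w _ ↦ w⁻¹) ?_ ?_ ?_ ?_ ?_
    · intro w hw
      simpa using hw
    · intro w hw
      simpa using hw
    · intro w _; exact inv_inv w
    · intro w _; exact inv_inv w
    · intro w hw
      rw [D.t_eq (mem_of_mem_erase hw) (ne_of_mem_erase hw)]
  rw [sum_erase_eq_sub D.zero_mem_K, sum_erase_eq_sub D.zero_mem_K, D.t_zero, D.card_eq',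
    D.gauss_zero, D.sum_comp_gauss hr hR fun z ↦ φ (-(#D.K : ℂ) * z)] at h1
  push_cast at h1
  rw [sub_eq_iff_eq_add.mp h1]
  simp only [neg_mul, mul_neg, neg_neg]
  ring

lemma sum_T : ∑ α ∈ D.K, ∑ β, D.T α β = (#D.K : ℂ) ^ 3 := by
  have h1 : ∀ α, ∑ β, D.T α β = (#D.K : ℂ) ^ 2 := by
    intro α
    simp only [T]
    rw [sum_comm]
    have h2 : ∀ x, ∑ β, D.e (D.form α β x) = if x = 0 then (Fintype.card F : ℂ) else 0 := by
      intro x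
      have h3 : x * D.σ x = 0 ↔ x = 0 := by simp
      simp only [form, AddChar.map_add_eq_mul]
      rw [← mul_sum, D.e_sum]
      simp only [h3]
      split_ifs with h <;> simp [h]
    rw [sum_congr rfl fun x _ ↦ h2 x, sum_ite_eq', if_pos (mem_univ _), D.card_eq']
    push_cast; rfl
  rw [sum_congr rfl fun α _ ↦ h1 α, sum_const, nsmul_eq_mul]
  ring

lemma card_zeros (x : F) : (#{y | x * D.τ x + y * D.τ y = 0 ∧ x * D.σ x + y * D.σ y = 0} : ℂ)
    = if x = 0 then 1 else (ZMod.χ₄ (#D.L) : ℂ) + 1 := by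
  split_ifs with hx
  · subst hx
    have : ({y | 0 * D.τ 0 + y * D.τ y = 0 ∧ 0 * D.σ 0 + y * D.σ y = 0} : Finset F) = {0} := by
      ext y; simp
    rw [this]; simp
  · have hτx : D.τ x ≠ 0 := by simpa using hx
    have hσx : D.σ x ≠ 0 := by simpa using hx
    have hcard : #{y | x * D.τ x + y * D.τ y = 0 ∧ x * D.σ x + y * D.σ y = 0}
        = #{u ∈ D.L | u ^ 2 = -1} := by
      symm
      refine card_bij' (fun u _ ↦ u * x) (fun y _ ↦ y / x) ?_ ?_ ?_ ?_
      · intro u hu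
        obtain ⟨huL, hu2⟩ := mem_filter.mp hu
        obtain ⟨h1, h2⟩ := D.mem_L_iff.mp huL
        rw [mem_filter, map_mul, map_mul, h1, h2]
        refine ⟨mem_univ _, ?_, ?_⟩
        · linear_combination x * D.τ x * hu2
        · linear_combination x * D.σ x * hu2
      · intro y hy
        obtain ⟨-, h1, h2⟩ := mem_filter.mp hy
        set u := y / x with hu
        have hyu : y = u * x := by rw [hu, div_mul_cancel₀ _ hx]
        rw [hyu, map_mul] at h1 h2
        have h3 : u * D.τ u = -1 := by
          apply mul_right_cancel₀ (mul_ne_zero hx hτx)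
          linear_combination h1
        have h4 : u * D.σ u = -1 := by
          apply mul_right_cancel₀ (mul_ne_zero hx hσx)
          linear_combination h2
        have hu0 : u ≠ 0 := by
          rintro h; rw [h] at h3; simp at h3
        have h5 : D.σ u = D.τ u := mul_left_cancel₀ hu0 (h4.trans h3.symm)
        have h6 : D.σ (D.τ u) = u := by rw [D.comm, h5, D.invol]
        rw [mem_filter]
        refine ⟨D.mem_L.mpr h6, ?_⟩
        rw [← h3, (D.mem_L_iff.mp (D.mem_L.mpr h6)).1, sq]
      · intro u _; exact mul_div_cancel_right₀ u hx
      · intro y _; exact div_mul_cancel₀ y hx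
    rw [hcard]
    exact_mod_cast congrArg (Int.cast : ℤ → ℂ) D.card_sqrt_neg_one

lemma sum_T_sq : ∑ α ∈ D.K, ∑ β, D.T α β ^ 2
    = (#D.K : ℂ) ^ 3 * (1 + ((#D.K : ℂ) ^ 2 - 1) * ((ZMod.χ₄ (#D.L) : ℂ) + 1)) := by
  have hxy : ∀ x y, ∑ α ∈ D.K, ∑ β, D.e (D.form α β x) * D.e (D.form α β y)
      = if x * D.τ x + y * D.τ y = 0 ∧ x * D.σ x + y * D.σ y = 0 then (#D.K : ℂ) ^ 3 else 0 := by
    intro x y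
    have h1 : ∀ α β, D.e (D.form α β x) * D.e (D.form α β y)
        = D.e (α * ((x * D.τ x + y * D.τ y) / 2)) * D.e (β * (x * D.σ x + y * D.σ y)) := by
      intro α β
      rw [← AddChar.map_add_eq_mul, ← AddChar.map_add_eq_mul, form, form]
      congr 1; ring
    have hK : (x * D.τ x + y * D.τ y) / 2 ∈ D.K := by
      rw [mem_K, map_div₀, map_add, map_mul, map_mul, D.invol, D.invol, D.τ_two]
      ring
    have h0 : (x * D.τ x + y * D.τ y) / 2 = 0 ↔ x * D.τ x + y * D.τ y = 0 := by
      simp [D.two_ne]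
    simp only [h1, ← mul_sum]
    rw [← sum_mul, D.sum_K hK, D.e_sum, D.card_eq']
    simp only [h0]
    by_cases ha : x * D.τ x + y * D.τ y = 0 <;> by_cases hb : x * D.σ x + y * D.σ y = 0 <;>
      simp [ha, hb]
    ring
  calc ∑ α ∈ D.K, ∑ β, D.T α β ^ 2
      = ∑ α ∈ D.K, ∑ β, ∑ x, ∑ y, D.e (D.form α β x) * D.e (D.form α β y) := by
        refine sum_congr rfl fun α _ ↦ sum_congr rfl fun β _ ↦ ?_
        rw [sq, T, sum_mul_sum]
    _ = ∑ x, ∑ y, ∑ α ∈ D.K, ∑ β, D.e (D.form α β x) * D.e (D.form α β y) := by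
        rw [sum_congr rfl fun α _ ↦ sum_comm, sum_comm]
        refine sum_congr rfl fun x _ ↦ ?_
        rw [sum_congr rfl fun α _ ↦ sum_comm, sum_comm]
    _ = ∑ x : F, (#D.K : ℂ) ^ 3 * (if x = 0 then 1 else (ZMod.χ₄ (#D.L) : ℂ) + 1) := by
        refine sum_congr rfl fun x _ ↦ ?_
        rw [sum_congr rfl fun y _ ↦ hxy x y, ← sum_filter, sum_const, nsmul_eq_mul, mul_comm,
          D.card_zeros x]
    _ = _ := by
        rw [← mul_sum, ← add_sum_erase univ
            (fun x : F ↦ if x = 0 then 1 else (ZMod.χ₄ (#D.L) : ℂ) + 1) (mem_univ 0), if_pos rfl,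
          sum_congr rfl fun x hx ↦ if_neg (ne_of_mem_erase hx), sum_const,
          card_erase_of_mem (mem_univ _), card_univ, nsmul_eq_mul,
          Nat.cast_sub Fintype.card_pos, D.card_eq']
        push_cast; rfl

lemma sum_T_mul_conj : ∑ α ∈ D.K, ∑ β, D.T α β * conj (D.T α β)
    = (#D.K : ℂ) ^ 3 * (2 * (#D.K : ℂ) ^ 2 - 1) := by
  have h := D.sum_card_rad fun _ ↦ 1
  have h1 : ∀ α ∈ D.K, ∑ β, D.T α β * conj (D.T α β)
      = (#D.K : ℂ) ^ 2 * ∑ β, ((#(D.rad α β) : ℂ) - 1) * 1 + (#D.K : ℂ) ^ 4 := by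
    intro α hα
    rw [sum_congr rfl fun β _ ↦ D.T_mul_conj hα β, ← mul_sum]
    simp only [mul_one, sum_sub_distrib, sum_const, nsmul_eq_mul, card_univ, D.card_eq']
    push_cast; ring
  rw [sum_congr rfl h1, sum_add_distrib, ← mul_sum, h]
  simp only [sum_const, nsmul_eq_mul, D.card_eq']
  push_cast; ring

/-- Nonzero degenerate pairs only take the values `-MQ` and `±Mr`. -/
lemma T_of_mem_rad {r : ℂ} (hr : r ^ 2 = (ZMod.χ₄ (#D.L) : ℂ) * #D.L) {α β x : F}
    (hα : α ∈ D.K) (h0 : α ≠ 0 ∨ β ≠ 0) (hx : x ≠ 0) (hrad : x ∈ D.rad α β) :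
    D.T α β = -(#D.K * #D.L) ∨ D.T α β = #D.K * r ∨ D.T α β = -(#D.K * r) := by
  obtain ⟨hw, hαw⟩ := (D.mem_rad_iff hα hx).mp hrad
  have hw0 : β * (x * D.σ x) ≠ 0 := by
    intro h
    rw [h] at hαw
    simp [hx] at h hαw
    tauto
  rw [D.T_scale α β hx, hαw, ← t, D.t_eq hw hw0]
  rcases D.gauss_values hr (β * (x * D.σ x))⁻¹ with h | h | h <;> rw [h] <;> simp

lemma mul_conj_sqrt {r : ℂ} (hr : r ^ 2 = (ZMod.χ₄ (#D.L) : ℂ) * #D.L) : r * conj r = #D.L := by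
  have h1 : Complex.normSq r ^ 2 = (#D.L : ℝ) ^ 2 := by
    rw [← map_pow, hr, map_mul, Complex.normSq_natCast]
    rcases D.χ₄_card_L with h | h <;> rw [h] <;> simp [sq]
  have h2 : Complex.normSq r = #D.L :=
    (sq_eq_sq₀ (Complex.normSq_nonneg _) (Nat.cast_nonneg _)).mp h1
  rw [Complex.mul_conj, h2]; simp

lemma sqrt_ne_natCast {r : ℂ} (hr : r ^ 2 = (ZMod.χ₄ (#D.L) : ℂ) * #D.L) {n : ℕ}
    (hn : n ^ 2 ≠ #D.L) : r ≠ n ∧ -r ≠ n := by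
  have h1 : r ^ 2 ≠ (n : ℂ) ^ 2 := by
    intro h
    rw [hr] at h
    have h2 : ZMod.χ₄ (#D.L) * (#D.L : ℤ) = (n : ℤ) ^ 2 := by exact_mod_cast h
    have h3 := D.one_lt_card_L
    rcases D.χ₄_card_L with h' | h' <;> rw [h'] at h2
    · apply hn
      have : ((n ^ 2 : ℕ) : ℤ) = (#D.L : ℕ) := by push_cast; linarith
      exact_mod_cast this
    · nlinarith [sq_nonneg (n : ℤ)]
  exact ⟨fun h ↦ h1 (by rw [h]), fun h ↦ h1 (by rw [← h, neg_sq])⟩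

/-- The number of pairs at which `T` takes the value `v`. -/
def count (v : ℂ) : ℕ := #{ab ∈ D.K ×ˢ (univ : Finset F) | D.T ab.1 ab.2 = v}

lemma count_eq_sum (v : ℂ) :
    (D.count v : ℂ) = ∑ α ∈ D.K, ∑ β, if D.T α β = v then 1 else 0 := by
  rw [count, card_filter, sum_product]
  push_cast; rfl

lemma mul_count {r : ℂ} (hr : r ^ 2 = (ZMod.χ₄ (#D.L) : ℂ) * #D.L) {R : ℕ}
    (hR : #D.K = #D.L * R) (v : ℂ) :
    (v * conj v - (#D.K : ℂ) ^ 2) * D.count v = (#D.K : ℂ) ^ 2 * (((#D.K : ℂ) ^ 2 - 1) *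
      ((if (#D.K : ℂ) ^ 2 = v then 1 else 0) + (R - 1) * (if -(#D.K * #D.L : ℂ) = v then 1 else 0)
        + ((#D.K : ℂ) - R) / 2 *
          ((if #D.K * r = v then 1 else 0) + if -(#D.K * r) = v then 1 else 0))) := by
  rw [← D.sum_card_rad_eq hr hR fun z ↦ if z = v then 1 else 0, D.count_eq_sum, mul_sum, mul_sum]
  refine sum_congr rfl fun α hα ↦ ?_
  rw [mul_sum, mul_sum]
  refine sum_congr rfl fun β _ ↦ ?_
  have h := D.T_mul_conj hα β
  rw [D.card_eq'] at h
  push_cast at h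
  split_ifs with hv
  · rw [← hv, h]; ring
  · ring

lemma card_mul_sqrt_ne {r : ℂ} (hr : r ^ 2 = (ZMod.χ₄ (#D.L) : ℂ) * #D.L) {n : ℕ}
    (hn : n ^ 2 ≠ #D.L) : (#D.K * r ≠ #D.K * n ∧ -(#D.K * r) ≠ #D.K * n) ∧
      #D.K * r ≠ -(#D.K * n : ℂ) ∧ -(#D.K * r) ≠ -(#D.K * n : ℂ) := by
  obtain ⟨h1, h2⟩ := D.sqrt_ne_natCast hr hn
  have hM : (#D.K : ℂ) ≠ 0 := Nat.cast_ne_zero.mpr D.card_pos_K.ne'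
  refine ⟨⟨?_, ?_⟩, ?_, ?_⟩
  · exact fun h ↦ h1 (mul_left_cancel₀ hM h)
  · exact fun h ↦ h2 (mul_left_cancel₀ hM (by linear_combination h))
  · exact fun h ↦ h2 (mul_left_cancel₀ hM (by linear_combination -h))
  · exact fun h ↦ h1 (mul_left_cancel₀ hM (by linear_combination -h))

lemma sqrt_ne_zero {r : ℂ} (hr : r ^ 2 = (ZMod.χ₄ (#D.L) : ℂ) * #D.L) : r ≠ 0 := by
  have h := D.one_lt_card_L
  exact_mod_cast (D.sqrt_ne_natCast hr (n := 0) (by omega)).1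

lemma card_mul_sqrt_ne_neg {r : ℂ} (hr : r ^ 2 = (ZMod.χ₄ (#D.L) : ℂ) * #D.L) :
    #D.K * r ≠ -(#D.K * r) := by
  have hM : (#D.K : ℂ) ≠ 0 := Nat.cast_ne_zero.mpr D.card_pos_K.ne'
  exact fun h ↦ mul_ne_zero hM (D.sqrt_ne_zero hr) (self_eq_neg.mp h)

lemma T_of_rad_ne {r : ℂ} (hr : r ^ 2 = (ZMod.χ₄ (#D.L) : ℂ) * #D.L) {α β : F} (hα : α ∈ D.K)
    (hrad : D.rad α β ≠ {0}) : D.T α β = (#D.K : ℂ) ^ 2 ∨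
      D.T α β = -(#D.K * #D.L) ∨ D.T α β = #D.K * r ∨ D.T α β = -(#D.K * r) := by
  obtain ⟨x, hx, hx0⟩ : ∃ x ∈ D.rad α β, x ≠ 0 := by
    by_contra! h
    exact hrad (eq_singleton_iff_unique_mem.mpr ⟨D.zero_mem_rad α β, h⟩)
  by_cases h0 : α ≠ 0 ∨ β ≠ 0
  · exact .inr (D.T_of_mem_rad hr hα h0 hx0 hx)
  · push Not at h0
    rw [h0.1, h0.2, D.T_zero_zero, D.card_eq']
    left; push_cast; rfl

lemma normSq_T_of_rad_eq {α β : F} (hα : α ∈ D.K) (hrad : D.rad α β = {0}) :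
    D.T α β * conj (D.T α β) = (#D.K : ℂ) ^ 2 := by
  rw [D.T_mul_conj hα, hrad, D.card_eq']
  simp

lemma card_sq_ne {R : ℕ} (hR : #D.K = #D.L * R) : #D.K ^ 2 ≠ #D.L := by
  have h1 := D.one_lt_card_L
  have h2 := D.card_pos_K
  have h3 : 0 < R := Nat.pos_of_ne_zero fun h ↦ by rw [h, mul_zero] at hR; omega
  nlinarith

/-- `Re (|T|² - T²)`, corrected at the values `±Mr`, is supported on the nondegenerate pairs. -/
lemma re_excess {r : ℂ} (hr : r ^ 2 = (ZMod.χ₄ (#D.L) : ℂ) * #D.L) {R : ℕ}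
    (hR : #D.K = #D.L * R) {α β : F} (hα : α ∈ D.K) :
    (D.T α β * conj (D.T α β) - D.T α β ^ 2
      - (#D.K : ℂ) ^ 2 * #D.L * (1 - (ZMod.χ₄ (#D.L) : ℂ)) *
        ((if D.T α β = #D.K * r then 1 else 0) + if D.T α β = -(#D.K * r) then 1 else 0)).re
      = if D.rad α β = {0} then 2 * (D.T α β).im ^ 2 else 0 := by
  have hQ := D.one_lt_card_L
  have hM : (#D.K : ℂ) ≠ 0 := Nat.cast_ne_zero.mpr D.card_pos_K.ne'
  have hrr := D.mul_conj_sqrt hr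
  have hne := D.card_mul_sqrt_ne_neg hr
  by_cases hrad : D.rad α β = {0}
  · have h := D.normSq_T_of_rad_eq hα hrad
    have hbad : ∀ r' : ℂ, r' * conj r' = #D.L → D.T α β ≠ #D.K * r' := by
      intro r' hr' hT
      rw [hT, map_mul, Complex.conj_natCast, mul_mul_mul_comm, hr', ← sq] at h
      have : (#D.L : ℂ) = 1 := mul_left_cancel₀ (pow_ne_zero 2 hM) (by rw [h, mul_one])
      have : #D.L = 1 := by exact_mod_cast this
      omega
    rw [if_pos hrad, if_neg (hbad r hrr), if_neg, add_zero, mul_zero, sub_zero, Complex.mul_conj,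
      Complex.sub_re, Complex.ofReal_re, Complex.normSq_apply, sq, Complex.mul_re]
    · ring
    · rw [← mul_neg]
      exact hbad (-r) (by rw [map_neg, neg_mul_neg, hrr])
  · rw [if_neg hrad]
    obtain ⟨⟨c1, c2⟩, -⟩ := D.card_mul_sqrt_ne hr (D.card_sq_ne hR)
    obtain ⟨-, b1, b2⟩ := D.card_mul_sqrt_ne hr (n := #D.L) (by nlinarith)
    rw [← sq] at c1 c2
    rcases D.T_of_rad_ne hr hα hrad with h | h | h | h <;> rw [h]
    · rw [if_neg c1.symm, if_neg c2.symm]; simp [sq]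
    · rw [if_neg b1.symm, if_neg b2.symm]; simp [sq]
    · rw [if_pos rfl, if_neg hne, map_mul, Complex.conj_natCast, mul_mul_mul_comm, hrr, mul_pow,
        hr, ← Complex.zero_re]
      congr 1; ring
    · rw [if_pos rfl, if_neg hne.symm, map_neg, neg_mul_neg, map_mul, Complex.conj_natCast,
        mul_mul_mul_comm, hrr, neg_sq, mul_pow, hr, ← Complex.zero_re]
      congr 1; ring

lemma count_sqrt {r : ℂ} (hr : r ^ 2 = (ZMod.χ₄ (#D.L) : ℂ) * #D.L) {R : ℕ}
    (hR : #D.K = #D.L * R) : 2 * (D.count (#D.K * r) : ℂ) = R * ((#D.K : ℂ) ^ 2 - 1) := by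
  have hQ := D.one_lt_card_L
  have hM : (#D.K : ℂ) ≠ 0 := Nat.cast_ne_zero.mpr D.card_pos_K.ne'
  have h := D.mul_count hr hR (#D.K * r)
  have h1 := (D.card_mul_sqrt_ne hr (D.card_sq_ne hR)).1.1
  have h2 := (D.card_mul_sqrt_ne hr (n := #D.L) (by nlinarith)).2.1
  rw [if_neg (by rw [sq]; exact h1.symm), if_neg h2.symm, if_pos rfl,
    if_neg (D.card_mul_sqrt_ne_neg hr).symm, map_mul, Complex.conj_natCast, mul_mul_mul_comm,
    D.mul_conj_sqrt hr] at h
  have hQ1 : (#D.L : ℂ) - 1 ≠ 0 := sub_ne_zero.mpr (by exact_mod_cast hQ.ne')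
  apply mul_left_cancel₀ (mul_ne_zero (pow_ne_zero 2 hM) hQ1)
  have hK : (#D.K : ℂ) = #D.L * R := by exact_mod_cast hR
  linear_combination 2 * h + (#D.K : ℂ) ^ 2 * ((#D.K : ℂ) ^ 2 - 1) * hK

lemma count_neg_card_mul {r : ℂ} (hr : r ^ 2 = (ZMod.χ₄ (#D.L) : ℂ) * #D.L) {R : ℕ}
    (hR : #D.K = #D.L * R) : ((#D.L : ℂ) ^ 2 - 1) * D.count (-(#D.K * #D.L))
      = (R - 1) * ((#D.K : ℂ) ^ 2 - 1) := by
  have hQ := D.one_lt_card_L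
  have hM : (#D.K : ℂ) ≠ 0 := Nat.cast_ne_zero.mpr D.card_pos_K.ne'
  have h := D.mul_count hr hR (-(#D.K * #D.L))
  obtain ⟨-, h1, h2⟩ := D.card_mul_sqrt_ne hr (n := #D.L) (by nlinarith)
  have h3 : (#D.K : ℂ) ^ 2 ≠ -(#D.K * #D.L) := by
    intro h
    have h0 : ((#D.K ^ 2 + #D.K * #D.L : ℕ) : ℂ) = 0 := by push_cast; rw [h]; ring
    have := Nat.cast_eq_zero.mp h0
    have := D.card_pos_K
    nlinarith
  rw [if_neg h3, if_pos rfl, if_neg h1, if_neg h2, map_neg, map_mul, Complex.conj_natCast,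
    Complex.conj_natCast] at h
  apply mul_left_cancel₀ (pow_ne_zero 2 hM)
  linear_combination h

lemma count_card_sq {r : ℂ} (hr : r ^ 2 = (ZMod.χ₄ (#D.L) : ℂ) * #D.L) {R : ℕ}
    (hR : #D.K = #D.L * R) : D.count ((#D.K : ℂ) ^ 2) = 1 := by
  have hQ := D.one_lt_card_L
  have hMpos := D.card_pos_K
  have hM : (#D.K : ℂ) ≠ 0 := Nat.cast_ne_zero.mpr hMpos.ne'
  have h := D.mul_count hr hR ((#D.K : ℂ) ^ 2)
  obtain ⟨⟨h1, h2⟩, -⟩ := D.card_mul_sqrt_ne hr (D.card_sq_ne hR)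
  have h3 : -(#D.K * #D.L : ℂ) ≠ (#D.K : ℂ) ^ 2 := by
    intro h
    have h0 : ((#D.K ^ 2 + #D.K * #D.L : ℕ) : ℂ) = 0 := by push_cast; rw [← h]; ring
    have := Nat.cast_eq_zero.mp h0
    nlinarith
  rw [if_pos rfl, if_neg h3, if_neg (by rw [sq]; exact h1), if_neg (by rw [sq]; exact h2),
    map_pow, Complex.conj_natCast] at h
  have h4 : (#D.K : ℂ) ^ 2 - 1 ≠ 0 := by
    have hKQ : #D.L ≤ #D.K := Nat.le_of_dvd hMpos ⟨R, hR⟩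
    have : 1 < #D.K ^ 2 := by nlinarith
    exact sub_ne_zero.mpr (by exact_mod_cast this.ne')
  have h5 : (D.count ((#D.K : ℂ) ^ 2) : ℂ) = 1 := by
    apply mul_left_cancel₀ (mul_ne_zero (pow_ne_zero 2 hM) h4)
    linear_combination h
  exact_mod_cast h5

lemma im_T {r : ℂ} (hr : r ^ 2 = (ZMod.χ₄ (#D.L) : ℂ) * #D.L) {R : ℕ}
    (hR : #D.K = #D.L * R) {α β : F} (hα : α ∈ D.K) (hrad : D.rad α β = {0}) :
    (D.T α β).im = 0 := by
  have hr' : (-r) ^ 2 = (ZMod.χ₄ (#D.L) : ℂ) * #D.L := by rw [neg_sq, hr]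
  have hsum : ∑ α ∈ D.K, ∑ β, (D.T α β * conj (D.T α β) - D.T α β ^ 2
      - (#D.K : ℂ) ^ 2 * #D.L * (1 - (ZMod.χ₄ (#D.L) : ℂ)) *
        ((if D.T α β = #D.K * r then 1 else 0) + if D.T α β = -(#D.K * r) then 1 else 0))
      = 0 := by
    have h1 := D.count_sqrt hr hR
    have h2 := D.count_sqrt hr' hR
    rw [mul_neg, D.count_eq_sum] at h2
    rw [D.count_eq_sum] at h1
    simp only [sum_sub_distrib, ← mul_sum, sum_add_distrib, D.sum_T_mul_conj, D.sum_T_sq]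
    have hK : (#D.K : ℂ) = #D.L * R := by exact_mod_cast hR
    linear_combination -(#D.K : ℂ) ^ 2 * #D.L * (1 - (ZMod.χ₄ (#D.L) : ℂ)) / 2 * (h1 + h2)
      + (#D.K : ℂ) ^ 2 * (1 - (ZMod.χ₄ (#D.L) : ℂ)) * ((#D.K : ℂ) ^ 2 - 1) * hK
  have h := congrArg Complex.re hsum
  simp only [Complex.re_sum] at h
  rw [sum_congr rfl fun α hα ↦ sum_congr rfl fun β _ ↦ D.re_excess hr hR (β := β) hα] at h
  have hnn : ∀ α β, 0 ≤ if D.rad α β = {0} then 2 * (D.T α β).im ^ 2 else 0 := by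
    intro α β; split_ifs <;> positivity
  have h' := (sum_eq_zero_iff_of_nonneg fun α _ ↦ sum_nonneg fun β _ ↦ hnn α β).mp h α hα
  have h'' := (sum_eq_zero_iff_of_nonneg fun β _ ↦ hnn α β).mp h' β (mem_univ β)
  rw [if_pos hrad] at h''
  simpa using h''

/-- The possible values of `T`. -/
lemma T_values {r : ℂ} (hr : r ^ 2 = (ZMod.χ₄ (#D.L) : ℂ) * #D.L) {R : ℕ}
    (hR : #D.K = #D.L * R) {α : F} (hα : α ∈ D.K) (β : F) :
    D.T α β = #D.K ∨ D.T α β = -#D.K ∨ D.T α β = #D.K * r ∨ D.T α β = -(#D.K * r) ∨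
      D.T α β = -(#D.K * #D.L) ∨ D.T α β = (#D.K : ℂ) ^ 2 := by
  by_cases hrad : D.rad α β = {0}
  · have h1 := D.normSq_T_of_rad_eq hα hrad
    rw [Complex.conj_eq_iff_im.mpr (D.im_T hr hR hα hrad), ← sq, sq_eq_sq_iff_eq_or_eq_neg] at h1
    tauto
  · have := D.T_of_rad_ne hr hα hrad
    tauto

lemma sum_T_apply {r : ℂ} (hr : r ^ 2 = (ZMod.χ₄ (#D.L) : ℂ) * #D.L) {R : ℕ}
    (hR : #D.K = #D.L * R) (f : ℂ → ℂ) :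
    ∑ α ∈ D.K, ∑ β, f (D.T α β) = f #D.K * D.count #D.K + f (-#D.K) * D.count (-#D.K)
      + f (#D.K * r) * D.count (#D.K * r) + f (-(#D.K * r)) * D.count (-(#D.K * r))
      + f (-(#D.K * #D.L)) * D.count (-(#D.K * #D.L))
      + f ((#D.K : ℂ) ^ 2) * D.count ((#D.K : ℂ) ^ 2) := by
  have hQ := D.one_lt_card_L
  have hMpos := D.card_pos_K
  have hKQ : #D.L ≤ #D.K := Nat.le_of_dvd hMpos ⟨R, hR⟩
  obtain ⟨⟨a1, a2⟩, a3, a4⟩ := D.card_mul_sqrt_ne hr (n := 1) (by omega)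
  obtain ⟨-, b3, b4⟩ := D.card_mul_sqrt_ne hr (n := #D.L) (by nlinarith)
  obtain ⟨⟨c1, c2⟩, -⟩ := D.card_mul_sqrt_ne hr (D.card_sq_ne hR)
  rw [Nat.cast_one, mul_one] at a1 a2 a3 a4
  rw [← sq] at c1 c2
  have d := D.card_mul_sqrt_ne_neg hr
  have n1 : (#D.K : ℂ) ≠ -#D.K := by
    rw [Ne, self_eq_neg]; exact_mod_cast hMpos.ne'
  have n2 : (#D.K : ℂ) ≠ -(#D.K * #D.L) := by
    have : (#D.K : ℤ) ≠ -(#D.K * #D.L) := by nlinarith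
    exact_mod_cast this
  have n3 : (#D.K : ℂ) ≠ #D.K ^ 2 := by
    have : #D.K ≠ #D.K ^ 2 := by nlinarith
    exact_mod_cast this
  have n4 : -(#D.K : ℂ) ≠ -(#D.K * #D.L) := by
    have : -(#D.K : ℤ) ≠ -(#D.K * #D.L) := by nlinarith
    exact_mod_cast this
  have n5 : -(#D.K : ℂ) ≠ #D.K ^ 2 := by
    have : -(#D.K : ℤ) ≠ #D.K ^ 2 := by nlinarith
    exact_mod_cast this
  have n6 : -(#D.K * #D.L : ℂ) ≠ #D.K ^ 2 := by
    have : -(#D.K * #D.L : ℤ) ≠ #D.K ^ 2 := by nlinarith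
    exact_mod_cast this
  simp only [D.count_eq_sum, mul_sum, ← sum_add_distrib]
  refine sum_congr rfl fun α hα ↦ sum_congr rfl fun β _ ↦ ?_
  rcases D.T_values hr hR hα β with h | h | h | h | h | h <;>
    rw [h]
  all_goals
    clear h
    generalize (#D.K : ℂ) ^ 2 = v₆ at *
    generalize -(#D.K * #D.L : ℂ) = v₅ at *
    generalize -(#D.K * r) = v₄ at *
    generalize #D.K * r = v₃ at *
    generalize -(#D.K : ℂ) = v₂ at *
    generalize (#D.K : ℂ) = v₁ at *
    simp [a1, a2, a3, a4, b3, b4, c1, c2, d, n1, n2, n3, n4, n5, n6, a1.symm, a2.symm, a3.symm,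
      a4.symm, b3.symm, b4.symm, c1.symm, c2.symm, d.symm, n1.symm, n2.symm, n3.symm, n4.symm,
      n5.symm, n6.symm]

lemma count_card {r : ℂ} (hr : r ^ 2 = (ZMod.χ₄ (#D.L) : ℂ) * #D.L) {R : ℕ}
    (hR : #D.K = #D.L * R) :
    2 * ((#D.L : ℂ) + 1) * D.count #D.K = #D.L * ((#D.K : ℂ) - 1) * ((#D.K : ℂ) + 1) ^ 2 ∧
    2 * ((#D.L : ℂ) - 1) * D.count (-#D.K)
      = #D.L * ((#D.K : ℂ) - 1) * ((#D.K : ℂ) ^ 2 - 2 * (#D.K * R) + 1) := by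
  have hr' : (-r) ^ 2 = (ZMod.χ₄ (#D.L) : ℂ) * #D.L := by rw [neg_sq, hr]
  have e1 := D.sum_T_apply hr hR fun _ ↦ 1
  have e2 := D.sum_T_apply hr hR fun z ↦ z
  rw [D.sum_T] at e2
  simp only [sum_const, nsmul_eq_mul, mul_one, one_mul, card_univ, D.card_eq'] at e1
  push_cast at e1
  have h1 := D.count_sqrt hr hR
  have h2 := D.count_sqrt hr' hR
  rw [mul_neg] at h2
  have h3 := D.count_neg_card_mul hr hR
  have h4 : (D.count ((#D.K : ℂ) ^ 2) : ℂ) = 1 := by exact_mod_cast D.count_card_sq hr hR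
  have hK : (#D.K : ℂ) = #D.L * R := by exact_mod_cast hR
  have hM : (#D.K : ℂ) ≠ 0 := Nat.cast_ne_zero.mpr D.card_pos_K.ne'
  have hQ := D.one_lt_card_L
  have hQ1 : (#D.L : ℂ) - 1 ≠ 0 := sub_ne_zero.mpr (by exact_mod_cast hQ.ne')
  have hQ2 : (#D.L : ℂ) + 1 ≠ 0 := by exact_mod_cast (#D.L).succ_ne_zero
  generalize (D.count (#D.K * r) : ℂ) = A at *
  generalize (D.count (-(#D.K * r)) : ℂ) = B at *
  generalize (D.count (-(#D.K * #D.L)) : ℂ) = C at *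
  generalize (D.count ((#D.K : ℂ) ^ 2) : ℂ) = E at *
  generalize (D.count (#D.K : ℂ) : ℂ) = X at *
  generalize (D.count (-#D.K : ℂ) : ℂ) = Y at *
  generalize (#D.K : ℂ) = M at *
  generalize (#D.L : ℂ) = Q at *
  generalize (R : ℂ) = R at *
  have hAB : A = B := by linear_combination (h1 - h2) / 2
  subst hAB h4
  have hA : A = R * (M ^ 2 - 1) / 2 := by linear_combination h1 / 2
  have hC : C = (R - 1) * (M ^ 2 - 1) / ((Q - 1) * (Q + 1)) := by
    field_simp; linear_combination h3
  have e3 : X - Y = M ^ 2 - M + Q * C := by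
    apply mul_left_cancel₀ hM
    linear_combination -e2
  have e4 : X + Y = M ^ 3 - 1 - 2 * A - C := by linear_combination -e1
  constructor
  · have : X = (M ^ 2 - M + Q * C + (M ^ 3 - 1 - 2 * A - C)) / 2 := by
      linear_combination (e3 + e4) / 2
    rw [this, hA, hC, hK]
    field_simp
    ring
  · have : Y = (M ^ 3 - 1 - 2 * A - C - (M ^ 2 - M + Q * C)) / 2 := by
      linear_combination (e4 - e3) / 2
    rw [this, hA, hC, hK]
    field_simp
    ring

end TwistedField

section Frobenius

open Finset

lemma card_pow_pow_eq_self {p : ℕ} [Fact p.Prime] {F : Type*} [Field F] [Fintype F] {n : ℕ}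
    (hF : Fintype.card F = p ^ n) {j : ℕ} (hj : j ∣ n) :
    #{x : F | x ^ p ^ j = x} = p ^ j := by
  have hp : p.Prime := Fact.out
  have hpos : 0 < p ^ j := pow_pos hp.pos j
  have h0 : (0 : F) ∈ ({x : F | x ^ p ^ j = x} : Finset F) := by simp [hp.ne_zero]
  have hdvd : p ^ j - 1 ∣ p ^ n - 1 := Nat.pow_sub_one_dvd_pow_sub_one p hj
  have h1 : #(({x : F | x ^ p ^ j = x} : Finset F).erase 0)
      = Nat.card (powMonoidHom (p ^ j - 1) : Fˣ →* Fˣ).ker := by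
    rw [Nat.card_eq_fintype_card, Fintype.card_subtype]
    symm
    refine card_bij (fun u _ ↦ (u : F)) ?_ (fun u _ v _ h ↦ Units.ext h) ?_
    · intro u hu
      have hu' : u ^ (p ^ j - 1) = 1 := by simpa [MonoidHom.mem_ker] using hu
      rw [mem_erase, mem_filter]
      refine ⟨u.ne_zero, mem_univ _, ?_⟩
      rw [← Nat.sub_add_cancel hpos, pow_succ, ← Units.val_pow_eq_pow_val, hu', Units.val_one,
        one_mul]
    · intro x hx
      rw [mem_erase, mem_filter] at hx
      refine ⟨Units.mk0 x hx.1, ?_, rfl⟩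
      rw [mem_filter, MonoidHom.mem_ker, powMonoidHom_apply]
      refine ⟨mem_univ _, Units.ext (mul_right_cancel₀ hx.1 ?_)⟩
      rw [Units.val_pow_eq_pow_val, Units.val_mk0, ← pow_succ, Nat.sub_add_cancel hpos, hx.2.2,
        Units.val_one, one_mul]
  rw [IsCyclic.card_powMonoidHom_ker, Nat.card_units, Nat.card_eq_fintype_card, hF,
    Nat.gcd_eq_right hdvd] at h1
  have := card_erase_of_mem h0
  have := card_pos.mpr ⟨0, h0⟩
  omega

variable {p : ℕ} [Fact p.Prime] {F : Type} [Field F] [Algebra (ZMod p) F]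

variable (p F) in
/-- The canonical additive character of `F`. -/
def traceChar : AddChar F ℂ :=
  ZMod.stdAddChar.compAddMonoidHom (Algebra.trace (ZMod p) F).toAddMonoidHom

lemma traceChar_apply (x : F) :
    traceChar p F x = ZMod.stdAddChar (Algebra.trace (ZMod p) F x) := rfl

lemma expChar_eq_stdAddChar (c : ZMod p) : expChar p c = ZMod.stdAddChar c := by
  conv_rhs => rw [← ZMod.natCast_zmod_val c, ← Int.cast_natCast, ZMod.stdAddChar_coe]
  simp [expChar]

lemma fToZMod_algebraMap (c : ZMod p) : fToZMod p (algebraMap (ZMod p) F c) = c :=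
  Function.leftInverse_invFun (algebraMap (ZMod p) F).injective c

/-- Iterating an anti-invariance under a power of the Frobenius map. -/
lemma pow_pow_mul_eq {R : Type*} [CommRing R] {p a : ℕ} (hp : Odd p) {v : R}
    (hv : v ^ p ^ a = -v) (j : ℕ) : v ^ p ^ (a * j) = (-1) ^ j * v := by
  induction j with
  | zero => simp
  | succ j ih =>
    rw [mul_add_one, pow_add, pow_mul, ih, mul_pow, hv, pow_right_comm, hp.pow.neg_one_pow]
    ring

lemma pow_pow_gcd_iff {R : Type*} [Monoid R] (p m k : ℕ) (x : R) :
    x ^ p ^ m = x ∧ x ^ p ^ k = x ↔ x ^ p ^ Nat.gcd m k = x := by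
  have h : ∀ j, x ^ p ^ j = x ↔ Function.IsPeriodicPt (fun y : R ↦ y ^ p) j x := by
    intro j
    rw [Function.IsPeriodicPt, Function.IsFixedPt, pow_iterate]
  rw [h, h, h]
  exact ⟨fun h ↦ h.1.gcd h.2, fun h ↦ ⟨h.trans_dvd (Nat.gcd_dvd_left _ _),
    h.trans_dvd (Nat.gcd_dvd_right _ _)⟩⟩

/-- If `gcd(m+k, 2k) = gcd(m,k)`, the `p ^ m`- and `p ^ k`-Frobenius maps have no common nonzero
anti-invariant. -/
lemma eq_zero_of_pow_pow_eq_neg {R : Type*} [CommRing R] [NoZeroDivisors R] (h2 : (2 : R) ≠ 0)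
    {p m k : ℕ} (hp : Odd p) (hm : 0 < m) (hgcd : Nat.gcd (m + k) (2 * k) = Nat.gcd m k) {v : R}
    (hvm : v ^ p ^ m = -v) (hvk : v ^ p ^ k = -v) : v = 0 := by
  obtain ⟨m', k', hmk, hm', hk'⟩ := Nat.exists_coprime m k
  set d := Nat.gcd m k
  have hd : 0 < d := Nat.gcd_pos_of_pos_left k hm
  have hodd : Odd (m' + k') := by
    by_contra hodd
    rw [Nat.not_odd_iff_even] at hodd
    have h1 : 2 * d ∣ Nat.gcd (m + k) (2 * k) := by
      refine Nat.dvd_gcd ?_ (Nat.mul_dvd_mul_left 2 ⟨k', by linarith⟩)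
      have := Nat.mul_dvd_mul_right hodd.two_dvd d
      rwa [add_mul, ← hm', ← hk'] at this
    rw [hgcd] at h1
    have := Nat.le_of_dvd hd h1
    omega
  have h1 := pow_pow_mul_eq hp hvm k'
  have h3 := pow_pow_mul_eq hp hvk m'
  have hmk' : m * k' = k * m' := by
    calc m * k' = m' * d * k' := by rw [← hm']
      _ = k' * d * m' := by ring
      _ = k * m' := by rw [← hk']
  rw [hmk', h3] at h1
  have h4 : (-1 : R) ^ m' * (-1) ^ m' = 1 := by rw [← mul_pow]; simp
  have h5 : (-1 : R) ^ m' * (-1) ^ k' = -1 := by rw [← pow_add, hodd.neg_one_pow]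
  refine (mul_eq_zero.mp (?_ : 2 * v = 0)).resolve_left h2
  linear_combination (-1) ^ m' * h1 - v * h4 + v * h5

lemma two_ne_zero_of_odd_prime (hp2 : p ≠ 2) : (2 : F) ≠ 0 := by
  have : CharP F p := charP_of_injective_algebraMap (algebraMap (ZMod p) F).injective p
  exact Ring.two_ne_zero (by rwa [ringChar.eq F p])

variable [Fintype F]

lemma finrank_zmod_eq {n : ℕ} (hF : Fintype.card F = p ^ n) : Module.finrank (ZMod p) F = n := by
  have h := Module.card_eq_pow_finrank (K := ZMod p) (V := F)
  rw [hF, ZMod.card] at h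
  exact (Nat.pow_right_injective (Fact.out : p.Prime).two_le h).symm

lemma trSum_eq_algebraMap_trace {n : ℕ} (hF : Fintype.card F = p ^ n) (x : F) :
    trSum p 1 n x = algebraMap (ZMod p) F (Algebra.trace (ZMod p) F x) := by
  rw [FiniteField.algebraMap_trace_eq_sum_pow, finrank_zmod_eq hF, Nat.card_zmod]
  simp [trSum]

lemma trSum_eq_algebraMap_trace_half {m : ℕ} (h2 : (2 : F) ≠ 0) (hF : Fintype.card F = p ^ (2 * m))
    {x : F} (hx : x ^ p ^ m = x) :
    trSum p 1 m x = algebraMap (ZMod p) F (Algebra.trace (ZMod p) F (x / 2)) := by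
  have : CharP F p := charP_of_injective_algebraMap (algebraMap (ZMod p) F).injective p
  obtain ⟨y, rfl⟩ : ∃ y, x = y + y := ⟨x / 2, by ring_nf; field_simp⟩
  have hy : y ^ p ^ m = y := by
    rw [add_pow_char_pow, ← two_mul, ← two_mul] at hx
    exact mul_left_cancel₀ h2 hx
  rw [← two_mul, mul_div_cancel_left₀ y h2, two_mul, ← trSum_eq_algebraMap_trace hF, trSum, trSum,
    two_mul, sum_range_add, ← sum_add_distrib]
  refine sum_congr rfl fun i _ ↦ ?_
  rw [one_mul, one_mul, pow_add p m i, pow_mul, hy, add_pow_char_pow]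

lemma traceChar_isPrimitive : (traceChar p F).IsPrimitive := by
  apply AddChar.IsPrimitive.of_ne_one
  intro h
  obtain ⟨x, hx⟩ := Algebra.trace_surjective (ZMod p) F 1
  have h1 := DFunLike.congr_fun h x
  rw [traceChar_apply, hx, AddChar.one_apply,
    ← AddChar.map_zero_eq_one (ZMod.stdAddChar (N := p))] at h1
  exact one_ne_zero ((ZMod.injective_stdAddChar (N := p)) h1)

lemma trace_pow_pow (j : ℕ) (x : F) :
    Algebra.trace (ZMod p) F (x ^ p ^ j) = Algebra.trace (ZMod p) F x := by
  induction j with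
  | zero => simp
  | succ j ih =>
    rw [pow_succ, pow_mul, ← ih]
    have h := Algebra.trace_eq_of_algEquiv (FiniteField.frobeniusAlgEquivOfAlgebraic (ZMod p) F)
      (x ^ p ^ j)
    rwa [FiniteField.coe_frobeniusAlgEquivOfAlgebraic, ZMod.card] at h

/-- The twisted field given by the `p ^ k`- and `p ^ m`-Frobenius maps. -/
def frobeniusTwist (hp2 : p ≠ 2) {m k : ℕ} (hm : 0 < m)
    (hgcd : Nat.gcd (m + k) (2 * k) = Nat.gcd m k) (hF : Fintype.card F = p ^ (2 * m)) :
    TwistedField F :=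
  have : CharP F p := charP_of_injective_algebraMap (algebraMap (ZMod p) F).injective p
  { σ := iterateFrobeniusEquiv F p k
    τ := iterateFrobeniusEquiv F p m
    e := traceChar p F
    two_ne := two_ne_zero_of_odd_prime hp2
    comm := fun x ↦ by simp only [iterateFrobeniusEquiv_def]; exact pow_right_comm _ _ _
    invol := fun x ↦ by
      simp only [iterateFrobeniusEquiv_def]
      rw [← pow_mul, ← pow_add, ← two_mul, ← hF, FiniteField.pow_card]
    prim := traceChar_isPrimitive
    e_σ := fun x ↦ by
      rw [iterateFrobeniusEquiv_def, traceChar_apply, trace_pow_pow, traceChar_apply]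
    e_τ := fun x ↦ by
      rw [iterateFrobeniusEquiv_def, traceChar_apply, trace_pow_pow, traceChar_apply]
    anti := fun v hm' hk' ↦ by
      rw [iterateFrobeniusEquiv_def] at hm' hk'
      exact eq_zero_of_pow_pow_eq_neg (two_ne_zero_of_odd_prime hp2)
        ((Fact.out : p.Prime).odd_of_ne_two hp2) hm hgcd hm' hk'
    card_eq := by
      rw [hF, mul_comm, pow_mul, ← card_pow_pow_eq_self hF (Nat.dvd_mul_left m 2)]
      congr 2 }

variable (hp2 : p ≠ 2) {m k : ℕ} (hm : 0 < m) (hgcd : Nat.gcd (m + k) (2 * k) = Nat.gcd m k)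
  (hF : Fintype.card F = p ^ (2 * m))

lemma frobeniusTwist_mem_K {x : F} : x ∈ (frobeniusTwist hp2 hm hgcd hF).K ↔ x ^ p ^ m = x := by
  rw [TwistedField.mem_K]
  exact Iff.rfl

lemma frobeniusTwist_card_K : #(frobeniusTwist hp2 hm hgcd hF).K = p ^ m := by
  rw [← card_pow_pow_eq_self hF (Nat.dvd_mul_left m 2)]
  congr 1

lemma frobeniusTwist_card_L : #(frobeniusTwist hp2 hm hgcd hF).L = p ^ Nat.gcd m k := by
  rw [← card_pow_pow_eq_self hF ((Nat.gcd_dvd_left m k).mul_left 2)]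
  congr 1
  ext x
  rw [TwistedField.mem_L_iff, mem_filter, ← pow_pow_gcd_iff, and_iff_right (mem_univ _)]
  exact Iff.rfl

lemma Tsum_eq_frobeniusTwist_T {α : F} (hα : α ^ p ^ m = α) (β : F) :
    Tsum p m (2 * m) k F α β = (frobeniusTwist hp2 hm hgcd hF).T α β := by
  refine sum_congr rfl fun x _ ↦ ?_
  have hxx : (x ^ p ^ m) ^ p ^ m = x := (frobeniusTwist hp2 hm hgcd hF).invol x
  have hx : (α * x ^ (p ^ m + 1)) ^ p ^ m = α * x ^ (p ^ m + 1) := by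
    rw [mul_pow, hα, pow_succ x, mul_pow, hxx, mul_comm x]
  rw [trSum_eq_algebraMap_trace_half (two_ne_zero_of_odd_prime hp2) hF hx,
    trSum_eq_algebraMap_trace hF, fToZMod_algebraMap, fToZMod_algebraMap, ← map_add,
    expChar_eq_stdAddChar]
  change _ = ZMod.stdAddChar (Algebra.trace (ZMod p) F
    (α / 2 * (x * x ^ p ^ m) + β * (x * x ^ p ^ k)))
  congr 2
  ring

lemma Tcount_eq_frobeniusTwist_count (v : ℂ) :
    Tcount p m (2 * m) k F v = (frobeniusTwist hp2 hm hgcd hF).count v := by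
  rw [Tcount, Nat.card_eq_fintype_card, Fintype.card_subtype, TwistedField.count]
  congr 1
  ext ⟨α, β⟩
  simp only [mem_filter, mem_univ, true_and, mem_product, and_true, frobeniusTwist_mem_K]
  refine and_congr_right fun hα ↦ ?_
  rw [Tsum_eq_frobeniusTwist_T hp2 hm hgcd hF hα]

end Frobenius

lemma sqrtStar_sq {q : ℕ} (hq : Odd q) : sqrtStar q ^ 2 = (ZMod.χ₄ q : ℂ) * q := by
  have h : (Real.sqrt q : ℂ) ^ 2 = q := by
    rw [← Complex.ofReal_pow, Real.sq_sqrt q.cast_nonneg, Complex.ofReal_natCast]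
  rw [sqrtStar]
  split_ifs with h1
  · rw [h, ZMod.χ₄_nat_one_mod_four h1]; simp
  · have h3 : q % 4 = 3 := by obtain ⟨j, rfl⟩ := hq; omega
    rw [mul_pow, h, ZMod.χ₄_nat_three_mod_four h3, Complex.I_sq]; simp

theorem stmt9 (p m k n d d' : ℕ) (hp : Nat.Prime p) (hodd : p % 2 = 1)
    (hm : 0 < m) (hn : n = 2 * m) (hk : k ≤ n - 1) (hkm : k ≠ m)
    (hd : d = Nat.gcd m k) (hd' : d' = Nat.gcd (m + k) (2 * k))
    (F : Type) [Field F] [Fintype F] [Algebra (ZMod p) F] (hF : Fintype.card F = p ^ n) (s : ℕ) (hs : s = n / d) (hcase : d' = d) :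
    (2 * ((p : ℤ) ^ d + 1) * (Tcount p m n k F ((p : ℂ) ^ m) : ℤ)
        = (p : ℤ) ^ d * ((p : ℤ) ^ m - 1) * ((p : ℤ) ^ m + 1) ^ 2) ∧
    (2 * ((p : ℤ) ^ d - 1) * (Tcount p m n k F (-(p : ℂ) ^ m) : ℤ)
        = (p : ℤ) ^ d * ((p : ℤ) ^ m - 1) * ((p : ℤ) ^ n - 2 * (p : ℤ) ^ (n - d) + 1)) ∧
    (2 * (Tcount p m n k F (sqrtStar (p ^ d) * (p : ℂ) ^ m) : ℤ)
        = (p : ℤ) ^ (m - d) * ((p : ℤ) ^ n - 1)) ∧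
    (2 * (Tcount p m n k F (-(sqrtStar (p ^ d) * (p : ℂ) ^ m)) : ℤ)
        = (p : ℤ) ^ (m - d) * ((p : ℤ) ^ n - 1)) ∧
    (((p : ℤ) ^ (2 * d) - 1) * (Tcount p m n k F (-(p : ℂ) ^ (m + d)) : ℤ)
        = ((p : ℤ) ^ (m - d) - 1) * ((p : ℤ) ^ n - 1)) ∧
    (Tcount p m n k F ((p : ℂ) ^ n) = 1) ∧
    (∀ α β : F, α ^ p ^ m = α →
      Tsum p m n k F α β = (p : ℂ) ^ m ∨
      Tsum p m n k F α β = -(p : ℂ) ^ m ∨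
      Tsum p m n k F α β = sqrtStar (p ^ d) * (p : ℂ) ^ m ∨
      Tsum p m n k F α β = -(sqrtStar (p ^ d) * (p : ℂ) ^ m) ∨
      Tsum p m n k F α β = -(p : ℂ) ^ (m + d) ∨
      Tsum p m n k F α β = (p : ℂ) ^ n) := by
  subst hn hd
  rw [hd'] at hcase
  have : Fact p.Prime := ⟨hp⟩
  have hp2 : p ≠ 2 := by rintro rfl; omega
  set d := Nat.gcd m k with hd
  set D := frobeniusTwist hp2 hm hcase hF with hD
  have hK : D.K.card = p ^ m := frobeniusTwist_card_K hp2 hm hcase hF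
  have hL : D.L.card = p ^ d := frobeniusTwist_card_L hp2 hm hcase hF
  have hdm : d ≤ m := Nat.gcd_le_left k hm
  have hR : D.K.card = D.L.card * p ^ (m - d) := by rw [hK, hL, ← pow_add, Nat.add_sub_cancel' hdm]
  have hr : sqrtStar (p ^ d) ^ 2 = (ZMod.χ₄ D.L.card : ℂ) * D.L.card := by
    rw [hL]
    exact sqrtStar_sq (Nat.odd_iff.mpr hodd).pow
  have hr' : (-sqrtStar (p ^ d)) ^ 2 = (ZMod.χ₄ D.L.card : ℂ) * D.L.card := by rw [neg_sq, hr]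
  have hcount : ∀ v, Tcount p m (2 * m) k F v = D.count v :=
    Tcount_eq_frobeniusTwist_count hp2 hm hcase hF
  have hKC : (D.K.card : ℂ) = (p : ℂ) ^ m := by rw [hK]; push_cast; rfl
  have hLC : (D.L.card : ℂ) = (p : ℂ) ^ d := by rw [hL]; push_cast; rfl
  have hnd : 2 * m - d = m + (m - d) := by omega
  obtain ⟨h1, h2⟩ := D.count_card hr hR
  have h3 := D.count_sqrt hr hR
  have h4 := D.count_sqrt hr' hR
  have h5 := D.count_neg_card_mul hr hR
  have h6 := D.count_card_sq hr hR
  simp only [hKC, hLC, ← hcount, Nat.cast_pow, mul_neg, ← pow_add, ← pow_mul,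
    mul_comm m 2, mul_comm d 2, mul_comm ((p : ℂ) ^ m) (sqrtStar _)] at h1 h2 h3 h4 h5 h6
  rw [hnd]
  refine ⟨mod_cast h1, mod_cast h2, mod_cast h3, mod_cast h4, mod_cast h5, h6, fun α β hα ↦ ?_⟩
  rw [Tsum_eq_frobeniusTwist_T hp2 hm hcase hF hα, mul_comm (sqrtStar _), ← hKC, mul_comm 2 m,
    pow_mul, pow_add, ← hKC, ← hLC]
  exact D.T_values hr hR ((frobeniusTwist_mem_K hp2 hm hcase hF).mpr hα) β
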